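/- arXiv:1809.09471 — 3 statements merged into one kernel-verified Lean document; each statement's English description precedes it below -/
import Mathlib

section
/- Let Σ ⊆ ℝ^d be a d-simplex and let T and S be flag simplices of Σ. Then there exists a projective transformation φ of ℝ^d, defined at every point of Σ, such that φ(Σ) = Σ and φ(T) ⊆ S. -/
open Filter Set MeasureTheory Metric
open scoped ENNReal Topology Pointwise RealInnerProductSpace

noncomputable section
open scoped Classical

abbrev Euc (d : ℕ) := EuclideanSpace ℝ (Fin d)

/-- The Hilbert distance on a bounded open convex set `U`. -/
def hilbertDist {d : ℕ} (U : Set (Euc d)) (p q : Euc d) : ℝ :=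
  if p = q then 0
  else
    (1 / 2) * Real.log
      (((1 - sInf {t : ℝ | p + t • (q - p) ∈ U}) / (- sInf {t : ℝ | p + t • (q - p) ∈ U})) *
        (sSup {t : ℝ | p + t • (q - p) ∈ U} / (sSup {t : ℝ | p + t • (q - p) ∈ U} - 1)))

/-- The closed Hilbert ball. -/
def hilbertBall {d : ℕ} (U : Set (Euc d)) (p : Euc d) (R : ℝ) : Set (Euc d) :=
  {q ∈ U | hilbertDist U p q ≤ R}

/-- The Finsler (Hilbert) norm `F_U(p, v)`. -/
def finslerNorm {d : ℕ} (U : Set (Euc d)) (p v : Euc d) : ℝ :=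
  if v = 0 then 0
  else (1 / 2) * (1 / sSup {t : ℝ | 0 < t ∧ p + t • v ∈ U}
                + 1 / sSup {t : ℝ | 0 < t ∧ p - t • v ∈ U})

/-- The unit ball `β_U(p)` of the Finsler norm. -/
def finslerUnitBall {d : ℕ} (U : Set (Euc d)) (p : Euc d) : Set (Euc d) :=
  {v | finslerNorm U p v < 1}

/-- The Busemann volume of `A ⊆ U`. -/
def busemannVol {d : ℕ} (U : Set (Euc d)) (A : Set (Euc d)) : ℝ≥0∞ :=
  ∫⁻ p in A, volume (Metric.ball (0 : Euc d) 1) / volume (finslerUnitBall U p)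

/-- The polar body `K°`. -/
def polarSet {d : ℕ} (K : Set (Euc d)) : Set (Euc d) :=
  {y | ∀ v ∈ K, ⟪v, y⟫ ≤ (1 : ℝ)}

/-- The Holmes–Thompson volume of `A ⊆ U`. -/
def htVol {d : ℕ} (U : Set (Euc d)) (A : Set (Euc d)) : ℝ≥0∞ :=
  ∫⁻ p in A, volume (polarSet (finslerUnitBall U p)) / volume (Metric.ball (0 : Euc d) 1)

/-- The asymptotic ball `AsB_U(y, R)`. -/
def asympBall {d : ℕ} (U : Set (Euc d)) (y : Euc d) (R : ℝ) : Set (Euc d) :=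
  if 0 < R then (fun u => y + (1 - Real.exp (-2 * R)) • (u - y)) '' U else ∅

/-- `F` is a face of the compact convex set `P`. -/
def IsFace {d : ℕ} (P F : Set (Euc d)) : Prop :=
  F.Nonempty ∧ IsClosed F ∧ Convex ℝ F ∧ IsExtreme ℝ P F

/-- The dimension of a set: the dimension of its affine span. -/
def faceDim {d : ℕ} (F : Set (Euc d)) : ℕ :=
  Module.finrank ℝ (affineSpan ℝ F).direction

/-- The set of maximal flags of a `dm`-dimensional polytope `P ⊆ ℝ^d`. -/
def flagSet {d : ℕ} (dm : ℕ) (P : Set (Euc d)) : Set (Fin (dm + 1) → Set (Euc d)) :=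
  {f | (∀ i, IsFace P (f i) ∧ faceDim (f i) = (i : ℕ)) ∧
       ∀ i j : Fin (dm + 1), i ≤ j → f i ⊆ f j}

/-- `N(ε, Ω)`: the least number of maximal flags of a `d`-dimensional polytope within
Hausdorff distance `ε` of `Ω`. -/
def flagNumber (d : ℕ) (Ω : Set (Euc d)) (ε : ℝ) : ℕ :=
  sInf {n | ∃ V : Finset (Euc d), V.Nonempty ∧
    faceDim (convexHull ℝ (V : Set (Euc d))) = d ∧
    Metric.hausdorffDist (convexHull ℝ (V : Set (Euc d))) Ω ≤ ε ∧
    (flagSet d (convexHull ℝ (V : Set (Euc d)))).ncard = n}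

/-- The flag approximability `a_f(Ω)`. -/
def flagApprox (d : ℕ) (Ω : Set (Euc d)) : ℝ :=
  liminf (fun ε : ℝ => Real.log (flagNumber d Ω ε) / (- Real.log ε)) (𝓝[>] 0)

/-- `s` is a `dm`-simplex. -/
def IsSimplexSet {d : ℕ} (dm : ℕ) (s : Set (Euc d)) : Prop :=
  ∃ v : Fin (dm + 1) → Euc d, AffineIndependent ℝ v ∧ s = convexHull ℝ (Set.range v)

/-- `S` is a flag simplex of the `dm`-dimensional polytope `P`. -/
def IsFlagSimplex {d : ℕ} (dm : ℕ) (P S : Set (Euc d)) : Prop :=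
  ∃ f ∈ flagSet dm P, ∃ v : Fin (dm + 1) → Euc d, AffineIndependent ℝ v ∧
    S = convexHull ℝ (Set.range v) ∧ ∀ i, v i ∈ intrinsicInterior ℝ (f i)

/-- The Macbeath region `M'(x)`. -/
def macbeath {d : ℕ} (Ω : Set (Euc d)) (x : Euc d) : Set (Euc d) :=
  (fun v => x + v) ''
    (((5 : ℝ)⁻¹ • ((fun w => w - x) '' Ω)) ∩ ((5 : ℝ)⁻¹ • ((fun w => x - w) '' Ω)))

/-- The Funk distance with respect to the convex body `Ω`. -/
def funkDist {d : ℕ} (Ω : Set (Euc d)) (p q : Euc d) : ℝ :=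
  if p = q then 0
  else Real.log (sSup {t : ℝ | p + t • (q - p) ∈ Ω} /
        (sSup {t : ℝ | p + t • (q - p) ∈ Ω} - 1))

/-- An affine functional commutes with affine combinations. -/
lemma aff_sum {d : ℕ} {ι : Type*} [Fintype ι] (g : Euc d →ᵃ[ℝ] ℝ) (p : ι → ℝ) (v : ι → Euc d)
    (hp : ∑ i, p i = 1) : g (∑ i, p i • v i) = ∑ i, p i * g (v i) := by
  have h := Finset.map_affineCombination Finset.univ v p hp g
  rw [Finset.affineCombination_eq_linear_combination _ _ _ hp,
    Finset.affineCombination_eq_linear_combination _ _ _ hp] at h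
  simpa using h

lemma aff_coord {d : ℕ} {ι : Type*} [Fintype ι] (B : AffineBasis ι ℝ (Euc d))
    (g : Euc d →ᵃ[ℝ] ℝ) (x : Euc d) : g x = ∑ k, B.coord k x * g (B k) := by
  rw [← aff_sum g (fun k => B.coord k x) B (B.sum_coord_apply_eq_one x),
    B.linear_combination_coord_eq_self]

lemma coord_sum {d : ℕ} {ι : Type*} [Fintype ι] (B : AffineBasis ι ℝ (Euc d))
    (p : ι → ℝ) (hp : ∑ i, p i = 1) (k : ι) : B.coord k (∑ i, p i • B i) = p k := by
  classical
  rw [aff_sum _ _ _ hp]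
  simp [AffineBasis.coord_apply]

lemma coord_lineMap {d : ℕ} {ι : Type*} (B : AffineBasis ι ℝ (Euc d)) (x y : Euc d) (t : ℝ)
    (k : ι) : B.coord k (AffineMap.lineMap x y t) = (1 - t) * B.coord k x + t * B.coord k y := by
  rw [AffineMap.apply_lineMap, AffineMap.lineMap_apply_module]
  simp

/-- Points of `F` have support contained in that of a relatively interior point. -/
lemma supp_le {d : ℕ} {ι : Type*} (B : AffineBasis ι ℝ (Euc d)) {F : Set (Euc d)}
    (hF : F ⊆ convexHull ℝ (Set.range B)) {x y : Euc d} (hx : x ∈ intrinsicInterior ℝ F)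
    (hy : y ∈ F) (k : ι) (hk : 0 < B.coord k y) : 0 < B.coord k x := by
  rw [mem_intrinsicInterior] at hx
  obtain ⟨x', hx', rfl⟩ := hx
  have hyA : y ∈ affineSpan ℝ F := subset_affineSpan ℝ F hy
  let γ : ℝ → affineSpan ℝ F := fun t =>
    ⟨AffineMap.lineMap y (x' : Euc d) t, AffineMap.lineMap_mem t hyA x'.2⟩
  have hγ : Continuous γ := Continuous.subtype_mk AffineMap.lineMap_continuous _
  have h1 : γ 1 = x' := by ext1; simp [γ]
  have hev : ∀ᶠ t in 𝓝 (1 : ℝ), γ t ∈ interior ((↑) ⁻¹' F : Set (affineSpan ℝ F)) := by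
    apply hγ.continuousAt.eventually_mem
    rw [h1]
    exact isOpen_interior.mem_nhds hx'
  obtain ⟨t, ht, ht1⟩ := ((hev.filter_mono nhdsWithin_le_nhds).and
    (self_mem_nhdsWithin : Set.Ioi (1 : ℝ) ∈ 𝓝[>] 1)).exists
  have htF : AffineMap.lineMap y (x' : Euc d) t ∈ F := by
    have := interior_subset ht
    exact this
  have := hF htF
  rw [B.convexHull_eq_nonneg_coord] at this
  have h2 := this k
  rw [coord_lineMap] at h2
  have ht1' : 1 < t := ht1
  have : 0 < t * B.coord k (x' : Euc d) := by nlinarith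
  exact (pos_iff_pos_of_mul_pos this).1 (by linarith)

/-- Vertices in the support of a point of a face belong to the face. -/
lemma vertex_mem {d : ℕ} {ι : Type*} [Fintype ι] (B : AffineBasis ι ℝ (Euc d)) {F : Set (Euc d)}
    (hF : IsExtreme ℝ (convexHull ℝ (Set.range B)) F) {x : Euc d} (hx : x ∈ F)
    (k : ι) (hk : 0 < B.coord k x) : B k ∈ F := by
  classical
  have hxS := hF.subset hx
  rw [B.convexHull_eq_nonneg_coord] at hxS
  set c := B.coord k x with hc
  have hz : AffineMap.lineMap (B k) x (1 + c) ∈ convexHull ℝ (Set.range B) := by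
    rw [B.convexHull_eq_nonneg_coord]
    intro j
    rw [coord_lineMap, B.coord_apply]
    by_cases h : j = k
    · subst h
      simp only [if_true]
      rw [← hc]
      nlinarith
    · rw [if_neg h]
      have := hxS j
      simp only [mul_zero, zero_add]
      positivity
  refine hF.left_mem_of_mem_openSegment (subset_convexHull ℝ _ ⟨k, rfl⟩) hz hx ?_
  refine ⟨c / (1 + c), 1 / (1 + c), by positivity, by positivity, by field_simp; ring, ?_⟩
  rw [AffineMap.lineMap_apply_module]
  have h1 : (1 : ℝ) + c ≠ 0 := by positivity
  rw [smul_add, smul_smul, smul_smul, ← add_assoc, ← add_smul]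
  have e1 : c / (1 + c) + 1 / (1 + c) * (1 - (1 + c)) = 0 := by field_simp; ring
  have e2 : 1 / (1 + c) * (1 + c) = 1 := by field_simp
  rw [e1, e2]
  simp

lemma face_card {d : ℕ} {ι : Type*} [Fintype ι] (B : AffineBasis ι ℝ (Euc d)) {F : Set (Euc d)}
    (hF : IsExtreme ℝ (convexHull ℝ (Set.range B)) F) {x : Euc d}
    (hx : x ∈ intrinsicInterior ℝ F) :
    (Finset.univ.filter fun k => 0 < B.coord k x).card = faceDim F + 1 := by
  classical
  set I := Finset.univ.filter fun k => 0 < B.coord k x with hI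
  have hxF : x ∈ F := intrinsicInterior_subset hx
  have hne : I.Nonempty := by
    by_contra h
    rw [Finset.not_nonempty_iff_eq_empty, Finset.filter_eq_empty_iff] at h
    have h1 := B.sum_coord_apply_eq_one x
    have : ∑ k, B.coord k x ≤ 0 := Finset.sum_nonpos fun k hk => not_lt.1 (h hk)
    linarith
  have hspan : affineSpan ℝ F = affineSpan ℝ (I.image B : Set (Euc d)) := by
    apply le_antisymm
    · apply affineSpan_le.2
      intro y hy
      have hyS := hF.subset hy
      rw [B.convexHull_eq_nonneg_coord] at hyS
      have hz : ∀ k, k ∉ I → B.coord k y = 0 := by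
        intro k hk
        by_contra h
        exact hk (by
          simp only [hI, Finset.mem_filter, Finset.mem_univ, true_and]
          exact supp_le B hF.subset hx hy k (lt_of_le_of_ne (hyS k) (Ne.symm h)))
      have hs : ∑ k ∈ I, B.coord k y = 1 := by
        rw [← B.sum_coord_apply_eq_one y]
        exact Finset.sum_subset (Finset.subset_univ _) fun k _ hk => hz k hk
      have hy' : y = I.affineCombination ℝ B (fun k => B.coord k y) := by
        rw [Finset.affineCombination_eq_linear_combination _ _ _ hs]
        conv_lhs => rw [← B.linear_combination_coord_eq_self y]
        symm
        exact Finset.sum_subset (Finset.subset_univ _) fun k _ hk => by rw [hz k hk, zero_smul]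
      rw [hy', Finset.coe_image]
      exact affineCombination_mem_affineSpan_image hs (fun i hi hi' => absurd hi hi') _
    · apply affineSpan_mono
      intro y hy
      simp only [Finset.coe_image, Set.mem_image] at hy
      obtain ⟨k, hk, rfl⟩ := hy
      exact vertex_mem B hF hxF k (by simpa [hI] using hk)
  obtain ⟨n, hn⟩ := Nat.exists_eq_succ_of_ne_zero (Finset.card_pos.2 hne).ne'
  have := B.ind.finrank_vectorSpan_image_finset (s := I) (n := n) hn
  rw [faceDim, hspan, direction_affineSpan]
  rw [hn, ← this]

/-- The combinatorics of a maximal chain. -/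
lemma chain_perm (d : ℕ) (I : Fin (d + 1) → Finset (Fin (d + 1)))
    (hc : ∀ i, (I i).card = (i : ℕ) + 1) (hm : ∀ i j, i ≤ j → I i ⊆ I j) :
    ∃ r : Equiv.Perm (Fin (d + 1)), ∀ i k, k ∈ I i ↔ r k ≤ i := by
  classical
  have hex : ∀ k, ∃ i, k ∈ I i := by
    intro k
    refine ⟨Fin.last d, ?_⟩
    have : I (Fin.last d) = Finset.univ := by
      rw [← Finset.card_eq_iff_eq_univ, hc]; simp
    simp [this]
  have hmin : ∀ k, ∃ i, k ∈ I i ∧ ∀ j, k ∈ I j → i ≤ j := by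
    intro k
    obtain ⟨i, hi, h⟩ := (Finset.univ.filter fun i => k ∈ I i).exists_min_image id
      (by obtain ⟨i, hi⟩ := hex k; exact ⟨i, by simpa using hi⟩)
    exact ⟨i, by simpa using hi, fun j hj => h j (by simpa using hj)⟩
  choose r hr1 hr2 using hmin
  have key : ∀ i k, k ∈ I i ↔ r k ≤ i := fun i k =>
    ⟨fun h => hr2 k i h, fun h => hm _ _ h (hr1 k)⟩
  have hsurj : Function.Surjective r := by
    intro i
    by_cases h0 : (i : ℕ) = 0
    · obtain ⟨k, hk⟩ := Finset.card_pos.1 (by rw [hc i]; omega : 0 < (I i).card)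
      refine ⟨k, ?_⟩
      have := (key i k).1 hk
      rw [Fin.le_def] at this
      exact Fin.ext (by omega)
    · let i' : Fin (d + 1) := ⟨(i : ℕ) - 1, by omega⟩
      obtain ⟨k, hk, hk'⟩ := Finset.exists_mem_notMem_of_card_lt_card
        (by rw [hc, hc]; change (i : ℕ) - 1 + 1 < (i : ℕ) + 1; omega : (I i').card < (I i).card)
      refine ⟨k, ?_⟩
      rw [key] at hk hk'
      rw [Fin.le_def] at hk hk'
      simp only [i'] at hk'
      exact Fin.ext (by omega)
  exact ⟨Equiv.ofBijective r (Finite.injective_iff_bijective.1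
    (Finite.injective_iff_surjective.2 hsurj)), key⟩

lemma flag_perm {d : ℕ} (B : AffineBasis (Fin (d + 1)) ℝ (Euc d))
    {f : Fin (d + 1) → Set (Euc d)} (hf : f ∈ flagSet d (convexHull ℝ (Set.range B)))
    {v : Fin (d + 1) → Euc d} (hv : ∀ i, v i ∈ intrinsicInterior ℝ (f i)) :
    ∃ r : Equiv.Perm (Fin (d + 1)), ∀ i k, (r k ≤ i → 0 < B.coord k (v i)) ∧
      (i < r k → B.coord k (v i) = 0) := by
  classical
  obtain ⟨h1, h2⟩ := hf
  obtain ⟨r, hr⟩ := chain_perm d (fun i => Finset.univ.filter fun k => 0 < B.coord k (v i))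
    (fun i => by rw [face_card B (h1 i).1.2.2.2 (hv i), (h1 i).2])
    (fun i j hij k hk => by
      simp only [Finset.mem_filter, Finset.mem_univ, true_and] at hk ⊢
      exact supp_le B (h1 j).1.2.2.2.subset (hv j)
        (h2 i j hij (intrinsicInterior_subset (hv i))) k hk)
  refine ⟨r, fun i k => ⟨fun h => by simpa using (hr i k).2 h, fun h => ?_⟩⟩
  have h3 : ¬ 0 < B.coord k (v i) := fun h' => absurd ((hr i k).1 (by simpa using h')) (not_le.2 h)
  have h4 := (h1 i).1.2.2.2.subset (intrinsicInterior_subset (hv i))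
  rw [B.convexHull_eq_nonneg_coord] at h4
  exact le_antisymm (not_lt.1 h3) (h4 k)

/-- Choice of the scaling parameter. -/
lemma exists_eps (n : ℕ) (a b c : Matrix (Fin n) (Fin n) ℝ)
    (ha : ∀ i j, j ≤ i → 0 < a i j) (ha0 : ∀ i j, i < j → a i j = 0)
    (hb : ∀ i j, j ≤ i → 0 < b i j) (hb0 : ∀ i j, i < j → b i j = 0) (hbc : b * c = 1) :
    ∃ ε : ℝ, 0 < ε ∧ ∀ i m, 0 ≤ ∑ j : Fin n, ε ^ (j : ℕ) * a i j * c j m := by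
  classical
  have hcinv : b⁻¹ = c := Matrix.inv_eq_right_inv hbc
  have hc0 : ∀ j m, j < m → c j m = 0 := by
    let _ : Invertible b := ⟨c, mul_eq_one_comm.1 hbc, hbc⟩
    have hbt : b.BlockTriangular OrderDual.toDual := fun i j hij => hb0 i j hij
    have := Matrix.blockTriangular_inv_of_blockTriangular hbt
    rw [hcinv] at this
    exact fun j m hjm => this hjm
  have hcd : ∀ m, 0 < c m m := by
    intro m
    have h := congrFun (congrFun hbc m) m
    rw [Matrix.mul_apply, Matrix.one_apply_eq, Finset.sum_eq_single m] at h
    · exact (pos_iff_pos_of_mul_pos (by rw [h]; exact one_pos)).1 (hb m m le_rfl)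
    · intro j _ hj
      rcases lt_or_gt_of_ne hj with h' | h'
      · rw [hc0 _ _ h', mul_zero]
      · rw [hb0 _ _ h', zero_mul]
    · simp
  have hev : ∀ i m, ∀ᶠ ε in 𝓝[>] (0 : ℝ), 0 ≤ ∑ j : Fin n, ε ^ (j : ℕ) * a i j * c j m := by
    intro i m
    by_cases him : i < m
    · refine Eventually.of_forall fun ε => (Finset.sum_eq_zero fun j _ => ?_).ge
      by_cases hj : j < m
      · rw [hc0 _ _ hj, mul_zero]
      · rw [ha0 i j (by order), mul_zero, zero_mul]
    · have hcont : Continuous fun ε : ℝ => ∑ j : Fin n, ε ^ ((j : ℕ) - (m : ℕ)) * a i j * c j m := by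
        fun_prop
      have h0 : 0 < ∑ j : Fin n, (0 : ℝ) ^ ((j : ℕ) - (m : ℕ)) * a i j * c j m := by
        rw [Finset.sum_eq_single m]
        · have := mul_pos (ha i m (not_lt.1 him)) (hcd m)
          simpa using this
        · intro j _ hj
          rcases lt_or_gt_of_ne hj with h' | h'
          · rw [hc0 _ _ h', mul_zero]
          · rw [zero_pow (by rw [Fin.lt_def] at h'; omega), zero_mul, zero_mul]
        · simp
      have h1 := (hcont.tendsto 0).eventually (lt_mem_nhds h0)
      filter_upwards [h1.filter_mono nhdsWithin_le_nhds, self_mem_nhdsWithin] with ε h2 h3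
      have h3' : 0 < ε := h3
      have : ∑ j : Fin n, ε ^ (j : ℕ) * a i j * c j m =
          ε ^ (m : ℕ) * ∑ j : Fin n, ε ^ ((j : ℕ) - (m : ℕ)) * a i j * c j m := by
        rw [Finset.mul_sum]
        refine Finset.sum_congr rfl fun j _ => ?_
        by_cases hj : j < m
        · rw [hc0 _ _ hj]; simp
        · rw [← mul_assoc, ← mul_assoc, ← pow_add]
          congr 4
          rw [Fin.lt_def] at hj
          omega
      rw [this]
      positivity
  obtain ⟨ε, h1, h2⟩ := ((eventually_all.2 fun i => eventually_all.2 fun m => hev i m).and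
    (self_mem_nhdsWithin : Set.Ioi (0 : ℝ) ∈ 𝓝[>] 0)).exists
  exact ⟨ε, h2, h1⟩

lemma simplex_basis {d : ℕ} (v : Fin (d + 1) → Euc d) (h : AffineIndependent ℝ v) :
    ∃ B : AffineBasis (Fin (d + 1)) ℝ (Euc d), ⇑B = v :=
  ⟨⟨v, h, h.affineSpan_eq_top_iff_card_eq_finrank_add_one.2 (by simp)⟩, rfl⟩

/-- Homogeneous form of the barycentric coordinates. -/
def coordMat {d : ℕ} (B : AffineBasis (Fin (d + 1)) ℝ (Euc d)) :
    Matrix (Fin (d + 1)) (Fin d ⊕ Unit) ℝ :=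
  Matrix.of fun k => Sum.elim (fun j => (B.coord k).linear (EuclideanSpace.single j 1))
    (fun _ => B.coord k 0)

/-- Homogeneous form of the vertices. -/
def vertMat {d : ℕ} (B : AffineBasis (Fin (d + 1)) ℝ (Euc d)) :
    Matrix (Fin d ⊕ Unit) (Fin (d + 1)) ℝ :=
  Matrix.of fun s k => Sum.elim (fun i => B k i) (fun _ => 1) s

lemma coord_eq_mat {d : ℕ} (B : AffineBasis (Fin (d + 1)) ℝ (Euc d)) (k : Fin (d + 1))
    (x : Euc d) :
    B.coord k x = (∑ j, coordMat B k (Sum.inl j) * x j) + coordMat B k (Sum.inr ()) := by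
  have h := congrFun (AffineMap.decomp (B.coord k)) x
  rw [h]
  simp only [coordMat, Matrix.of_apply, Sum.elim_inl, Sum.elim_inr, Pi.add_apply]
  congr 1
  have hx : x = ∑ j, x j • EuclideanSpace.single j (1 : ℝ) := by
    ext i
    simp [Finset.sum_apply, Pi.single_apply]
  conv_lhs => rw [hx]
  rw [map_sum]
  refine Finset.sum_congr rfl fun j _ => ?_
  rw [map_smul, smul_eq_mul, mul_comm]

lemma coordMat_mul_vertMat {d : ℕ} (B : AffineBasis (Fin (d + 1)) ℝ (Euc d)) :
    coordMat B * vertMat B = 1 := by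
  ext k l
  rw [Matrix.mul_apply, Fintype.sum_sum_type]
  have h := coord_eq_mat B k (B l)
  rw [B.coord_apply] at h
  simp only [Matrix.one_apply]
  rw [h]
  simp [vertMat]

lemma vertMat_mul_coordMat {d : ℕ} (B : AffineBasis (Fin (d + 1)) ℝ (Euc d)) :
    vertMat B * coordMat B = 1 :=
  (Matrix.mul_eq_one_comm_of_card_eq _ _ _ (by simp)).1 (coordMat_mul_vertMat B)

/-- The projective map permuting the vertices by `e` with homogeneous weights `L`. -/
def projMap {d : ℕ} (B : AffineBasis (Fin (d + 1)) ℝ (Euc d)) (e : Equiv.Perm (Fin (d + 1)))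
    (L : Fin (d + 1) → ℝ) (x : Euc d) : Euc d :=
  ∑ k, ((L k * B.coord k x) / ∑ l, L l * B.coord l x) • B (e k)

lemma denom_pos {d : ℕ} (B : AffineBasis (Fin (d + 1)) ℝ (Euc d))
    (L : Fin (d + 1) → ℝ) (hL : ∀ k, 0 < L k) {x : Euc d}
    (hx : ∀ k, 0 ≤ B.coord k x) : 0 < ∑ l, L l * B.coord l x := by
  refine lt_of_le_of_ne (Finset.sum_nonneg fun k _ => mul_nonneg (hL k).le (hx k)) fun h => ?_
  have h1 := (Finset.sum_eq_zero_iff_of_nonneg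
    (fun k _ => mul_nonneg (hL k).le (hx k))).1 h.symm
  have h2 := B.sum_coord_apply_eq_one x
  rw [Finset.sum_eq_zero fun k hk => (mul_eq_zero.1 (h1 k hk)).resolve_left (hL k).ne'] at h2
  exact zero_ne_one h2

lemma aff_projMap {d : ℕ} (B : AffineBasis (Fin (d + 1)) ℝ (Euc d))
    (e : Equiv.Perm (Fin (d + 1)))
    (L : Fin (d + 1) → ℝ) (hL : ∀ k, 0 < L k) {x : Euc d}
    (hx : ∀ k, 0 ≤ B.coord k x) (g : Euc d →ᵃ[ℝ] ℝ) :
    g (projMap B e L x) = (∑ k, L k * B.coord k x * g (B (e k))) / ∑ l, L l * B.coord l x := by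
  have hD := denom_pos B L hL hx
  rw [projMap, aff_sum g _ (fun k => B (e k)), Finset.sum_div]
  · exact Finset.sum_congr rfl fun k _ => by ring
  · rw [← Finset.sum_div, div_self hD.ne']

lemma coord_projMap {d : ℕ} (B : AffineBasis (Fin (d + 1)) ℝ (Euc d))
    (e : Equiv.Perm (Fin (d + 1)))
    (L : Fin (d + 1) → ℝ) (hL : ∀ k, 0 < L k) {x : Euc d}
    (hx : ∀ k, 0 ≤ B.coord k x) (k : Fin (d + 1)) :
    B.coord (e k) (projMap B e L x) = L k * B.coord k x / ∑ l, L l * B.coord l x := by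
  rw [aff_projMap B e L hL hx]
  congr 1
  simp [AffineBasis.coord_apply]

lemma projMap_nonneg {d : ℕ} (B : AffineBasis (Fin (d + 1)) ℝ (Euc d))
    (e : Equiv.Perm (Fin (d + 1)))
    (L : Fin (d + 1) → ℝ) (hL : ∀ k, 0 < L k) {x : Euc d}
    (hx : ∀ k, 0 ≤ B.coord k x) (k : Fin (d + 1)) : 0 ≤ B.coord k (projMap B e L x) := by
  obtain ⟨k, rfl⟩ := e.surjective k
  rw [coord_projMap B e L hL hx]
  exact div_nonneg (mul_nonneg (hL k).le (hx k)) (denom_pos B L hL hx).le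

lemma projMap_inv {d : ℕ} (B : AffineBasis (Fin (d + 1)) ℝ (Euc d))
    (e : Equiv.Perm (Fin (d + 1)))
    (L : Fin (d + 1) → ℝ) (hL : ∀ k, 0 < L k) {x : Euc d}
    (hx : ∀ k, 0 ≤ B.coord k x) :
    projMap B e L (projMap B e.symm (fun k => (L (e.symm k))⁻¹) x) = x := by
  set L' : Fin (d + 1) → ℝ := fun k => (L (e.symm k))⁻¹ with hL'def
  have hL' : ∀ k, 0 < L' k := fun k => inv_pos.2 (hL _)
  set y := projMap B e.symm L' x with hy
  have hy0 : ∀ k, 0 ≤ B.coord k y := projMap_nonneg B e.symm L' hL' hx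
  have hD := denom_pos B L' hL' hx
  set D := ∑ l, L' l * B.coord l x with hDdef
  have hc : ∀ k, L k * B.coord k y = B.coord (e k) x / D := by
    intro k
    have h := coord_projMap B e.symm L' hL' hx (e k)
    rw [Equiv.symm_apply_apply, ← hy, ← hDdef] at h
    rw [h]
    have := (hL k).ne'
    simp only [hL'def, Equiv.symm_apply_apply]
    field_simp
  have hsum : ∑ l, L l * B.coord l y = 1 / D := by
    rw [Finset.sum_congr rfl fun k _ => hc k, ← Finset.sum_div,
      Equiv.sum_comp e (fun k => B.coord k x), B.sum_coord_apply_eq_one]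
  apply B.ext_elem
  intro k
  obtain ⟨k, rfl⟩ := e.surjective k
  rw [coord_projMap B e L hL hy0, hsum, hc]
  field_simp

lemma projMap_image {d : ℕ} (B : AffineBasis (Fin (d + 1)) ℝ (Euc d))
    (e : Equiv.Perm (Fin (d + 1)))
    (L : Fin (d + 1) → ℝ) (hL : ∀ k, 0 < L k) :
    projMap B e L '' convexHull ℝ (Set.range B) = convexHull ℝ (Set.range B) := by
  rw [B.convexHull_eq_nonneg_coord]
  apply Set.Subset.antisymm
  · rintro _ ⟨x, hx, rfl⟩
    exact projMap_nonneg B e L hL hx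
  · intro x hx
    exact ⟨_, projMap_nonneg B e.symm _ (fun k => inv_pos.2 (hL _)) hx, projMap_inv B e L hL hx⟩

/-- `projMap` is given by an invertible block matrix. -/
lemma projMap_matrix {d : ℕ} (B : AffineBasis (Fin (d + 1)) ℝ (Euc d))
    (e : Equiv.Perm (Fin (d + 1)))
    (L : Fin (d + 1) → ℝ) (hL : ∀ k, 0 < L k) :
    ∃ (A : Matrix (Fin d) (Fin d) ℝ) (b c : Fin d → ℝ) (δ : ℝ),
      IsUnit (Matrix.fromBlocks A
        (Matrix.of fun i (_ : Unit) => b i)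
        (Matrix.of fun (_ : Unit) j => c j)
        (Matrix.of fun (_ : Unit) (_ : Unit) => δ)) ∧
      (∀ x : Euc d, (∑ j, c j * x j) + δ = ∑ l, L l * B.coord l x) ∧
      (∀ x : Euc d, ∀ i, projMap B e L x i =
        ((∑ j, A i j * x j) + b i) / ((∑ j, c j * x j) + δ)) := by
  classical
  set B' := B.reindex e.symm with hB'
  have hB'k : ∀ k, B' k = B (e k) := fun k => by simp [hB']
  set M : Matrix (Fin d ⊕ Unit) (Fin d ⊕ Unit) ℝ :=
    vertMat B' * Matrix.diagonal L * coordMat B with hM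
  have hMu : IsUnit M := by
    have h1 : M * (vertMat B * Matrix.diagonal (fun k => (L k)⁻¹) * coordMat B') = 1 := by
      have hdd : Matrix.diagonal L * Matrix.diagonal (fun k => (L k)⁻¹) = 1 := by
        rw [Matrix.diagonal_mul_diagonal, ← Matrix.diagonal_one]
        congr 1
        funext k
        exact mul_inv_cancel₀ (hL k).ne'
      calc M * (vertMat B * Matrix.diagonal (fun k => (L k)⁻¹) * coordMat B')
          = vertMat B' * (Matrix.diagonal L * (coordMat B * vertMat B) *
              Matrix.diagonal (fun k => (L k)⁻¹)) * coordMat B' := by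
            simp only [hM, Matrix.mul_assoc]
        _ = 1 := by
            rw [coordMat_mul_vertMat, Matrix.mul_one, hdd, Matrix.mul_one, vertMat_mul_coordMat]
    exact IsUnit.of_mul_eq_one _ h1
  have hrow : ∀ (s : Fin d ⊕ Unit) (x : Euc d),
      (∑ j, M s (Sum.inl j) * x j) + M s (Sum.inr ()) =
        ∑ k, vertMat B' s k * L k * B.coord k x := by
    intro s x
    have hMe : ∀ t, M s t = ∑ k, vertMat B' s k * L k * coordMat B k t := by
      intro t
      rw [hM, Matrix.mul_apply]
      simp [Matrix.mul_diagonal]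
    simp_rw [hMe, coord_eq_mat, mul_add, Finset.sum_add_distrib, Finset.sum_mul, Finset.mul_sum]
    congr 1
    rw [Finset.sum_comm]
    refine Finset.sum_congr rfl fun k _ => Finset.sum_congr rfl fun j _ => by ring
  have hden : ∀ x : Euc d, (∑ j, M (Sum.inr ()) (Sum.inl j) * x j) + M (Sum.inr ()) (Sum.inr ()) =
      ∑ l, L l * B.coord l x := by
    intro x
    rw [hrow]
    simp [vertMat]
  refine ⟨Matrix.of fun i j => M (Sum.inl i) (Sum.inl j), fun i => M (Sum.inl i) (Sum.inr ()),
    fun j => M (Sum.inr ()) (Sum.inl j), M (Sum.inr ()) (Sum.inr ()), ?_, hden, ?_⟩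
  · convert hMu using 1
    ext (i | i) (j | j) <;> rfl
  · intro x i
    simp only [Matrix.of_apply]
    rw [hden, hrow, projMap, Finset.sum_div]
    simp only [vertMat, Matrix.of_apply, Sum.elim_inl, hB'k]
    rw [WithLp.ofLp_sum, Finset.sum_apply]
    refine Finset.sum_congr rfl fun k _ => ?_
    simp only [PiLp.smul_apply, smul_eq_mul]
    ring

/-- The weights can be chosen so that `T` is mapped into `S`. -/
lemma projMap_subset {d : ℕ} (B C : AffineBasis (Fin (d + 1)) ℝ (Euc d))
    (t : Fin (d + 1) → Euc d) (r q : Equiv.Perm (Fin (d + 1)))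
    (hr : ∀ i k, (r k ≤ i → 0 < B.coord k (t i)) ∧ (i < r k → B.coord k (t i) = 0))
    (hq : ∀ i k, (q k ≤ i → 0 < B.coord k (C i)) ∧ (i < q k → B.coord k (C i) = 0)) :
    ∃ L : Fin (d + 1) → ℝ, (∀ k, 0 < L k) ∧
      projMap B (r.trans q.symm) L '' convexHull ℝ (Set.range t) ⊆ convexHull ℝ (Set.range C) := by
  classical
  obtain ⟨ε, hε, h⟩ := exists_eps (d + 1) (Matrix.of fun i j => B.coord (r.symm j) (t i))
    (Matrix.of fun i j => B.coord (q.symm j) (C i)) (Matrix.of fun j m => C.coord m (B (q.symm j)))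
    (fun i j hij => (hr i (r.symm j)).1 (by simpa using hij))
    (fun i j hij => (hr i (r.symm j)).2 (by simpa using hij))
    (fun i j hij => (hq i (q.symm j)).1 (by simpa using hij))
    (fun i j hij => (hq i (q.symm j)).2 (by simpa using hij))
    (by
      ext i m
      rw [Matrix.mul_apply]
      simp only [Matrix.of_apply]
      rw [Equiv.sum_comp q.symm (fun k => B.coord k (C i) * C.coord m (B k)), ← aff_coord B,
        C.coord_apply, Matrix.one_apply]
      simp only [eq_comm])
  set L : Fin (d + 1) → ℝ := fun k => ε ^ (r k : ℕ) with hLdef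
  have hL : ∀ k, 0 < L k := fun k => pow_pos hε _
  refine ⟨L, hL, ?_⟩
  have ht0 : ∀ i k, 0 ≤ B.coord k (t i) := by
    intro i k
    rcases le_or_gt (r k) i with h' | h'
    · exact ((hr i k).1 h').le
    · exact ((hr i k).2 h').ge
  have hti : ∀ i m, 0 ≤ ∑ k, L k * B.coord k (t i) * C.coord m (B (r.trans q.symm k)) := by
    intro i m
    have := h i m
    rw [← Equiv.sum_comp r] at this
    simpa [hLdef] using this
  rintro _ ⟨x, hx, rfl⟩
  obtain ⟨α, hα0, hα1, rfl⟩ : ∃ α : Fin (d + 1) → ℝ, (∀ i, 0 ≤ α i) ∧ ∑ i, α i = 1 ∧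
      ∑ i, α i • t i = x := by
    rw [convexHull_range_eq_exists_affineCombination] at hx
    obtain ⟨s, p, hp0, hp1, rfl⟩ := hx
    refine ⟨fun i => if i ∈ s then p i else 0, fun i => ?_, ?_, ?_⟩
    · dsimp only
      split_ifs with hi
      · exact hp0 i hi
      · exact le_rfl
    · simpa using hp1
    · rw [Finset.affineCombination_eq_linear_combination _ _ _ hp1]
      simp [ite_smul]
  have hxc : ∀ k, B.coord k (∑ i, α i • t i) = ∑ i, α i * B.coord k (t i) := fun k =>
    aff_sum _ _ _ hα1
  have hx0 : ∀ k, 0 ≤ B.coord k (∑ i, α i • t i) := fun k => by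
    rw [hxc]
    exact Finset.sum_nonneg fun i _ => mul_nonneg (hα0 i) (ht0 i k)
  rw [C.convexHull_eq_nonneg_coord]
  intro m
  rw [aff_projMap B _ L hL hx0]
  refine div_nonneg ?_ (denom_pos B L hL hx0).le
  have : ∑ k, L k * B.coord k (∑ i, α i • t i) * C.coord m (B (r.trans q.symm k)) =
      ∑ i, α i * ∑ k, L k * B.coord k (t i) * C.coord m (B (r.trans q.symm k)) := by
    simp_rw [hxc, Finset.mul_sum, Finset.sum_mul]
    rw [Finset.sum_comm]
    exact Finset.sum_congr rfl fun i _ => Finset.sum_congr rfl fun k _ => by ring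
  rw [this]
  exact Finset.sum_nonneg fun i _ => mul_nonneg (hα0 i) (hti i m)

/-- Given two flag simplices `T` and `S` of a `d`-simplex `Sig ⊆ ℝ^d`, there is
a projective transformation `φ` of `ℝ^d`, defined at every point of `Sig`, with
`φ(Sig) = Sig` and `φ(T) ⊆ S`. -/
theorem exists_projective_map_flag_simplices (d : ℕ) (Sig T S : Set (Euc d))
    (hSig : IsSimplexSet d Sig)
    (hT : IsFlagSimplex d Sig T) (hS : IsFlagSimplex d Sig S) :
    ∃ (A : Matrix (Fin d) (Fin d) ℝ) (b c : Fin d → ℝ) (δ : ℝ) (φ : Euc d → Euc d),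
      IsUnit (Matrix.fromBlocks A
        (Matrix.of fun i (_ : Unit) => b i)
        (Matrix.of fun (_ : Unit) j => c j)
        (Matrix.of fun (_ : Unit) (_ : Unit) => δ)) ∧
      (∀ x ∈ Sig, (∑ j, c j * x j) + δ ≠ 0) ∧
      (∀ x ∈ Sig, ∀ i, φ x i = ((∑ j, A i j * x j) + b i) / ((∑ j, c j * x j) + δ)) ∧
      φ '' Sig = Sig ∧ φ '' T ⊆ S := by
  obtain ⟨w, hw, rfl⟩ := hSig
  obtain ⟨B, rfl⟩ := simplex_basis w hw
  obtain ⟨f, hf, t, -, rfl, ht⟩ := hT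
  obtain ⟨g, hg, s, hs, rfl, hsg⟩ := hS
  obtain ⟨C, rfl⟩ := simplex_basis s hs
  obtain ⟨r, hr⟩ := flag_perm B hf ht
  obtain ⟨q, hq⟩ := flag_perm B hg hsg
  obtain ⟨L, hL, hsub⟩ := projMap_subset B C t r q hr hq
  obtain ⟨A, b, c, δ, hu, hden, hval⟩ := projMap_matrix B (r.trans q.symm) L hL
  refine ⟨A, b, c, δ, projMap B (r.trans q.symm) L, hu, fun x hx => ?_, fun x _ i => hval x i,
    projMap_image B _ L hL, hsub⟩
  rw [B.convexHull_eq_nonneg_coord] at hx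
  rw [hden]
  exact (denom_pos B L hL hx).ne'

end
end

section
/- Let P ⊆ ℝ^d be a d-dimensional polytope and let S be a flag simplex of P. Then there exist d-simplices U and V with U ⊆ P ⊆ V such that S is a flag simplex of U and S is a flag simplex of V. -/
open Filter Set MeasureTheory Metric
open scoped ENNReal Topology Pointwise RealInnerProductSpace

noncomputable section
open scoped Classical

/-- Points in the relative interior can be pushed past, away from any point of the affine span. -/
theorem exists_push {d : ℕ} {F : Set (Euc d)} {x y : Euc d} (hx : x ∈ intrinsicInterior ℝ F)
    (hy : y ∈ affineSpan ℝ F) : ∃ ε : ℝ, 0 < ε ∧ x + ε • (x - y) ∈ F := by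
  obtain ⟨x', hx', rfl⟩ := mem_intrinsicInterior.1 hx
  have hmem : ∀ t : ℝ, (x' : Euc d) + t • ((x' : Euc d) - y) ∈ affineSpan ℝ F := by
    intro t
    have h := AffineSubspace.smul_vsub_vadd_mem (affineSpan ℝ F) t x'.2 hy x'.2
    simpa [add_comm] using h
  let φ : ℝ → affineSpan ℝ F := fun t => ⟨(x' : Euc d) + t • ((x' : Euc d) - y), hmem t⟩
  have hφ : Continuous φ := by
    apply Continuous.subtype_mk
    fun_prop
  have h0 : φ 0 = x' := by
    apply Subtype.ext
    simp [φ]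
  have hnb : φ ⁻¹' (((↑) : affineSpan ℝ F → Euc d) ⁻¹' F) ∈ 𝓝 (0 : ℝ) := by
    apply hφ.continuousAt.preimage_mem_nhds
    rw [h0]
    exact mem_interior_iff_mem_nhds.1 hx'
  obtain ⟨ε, hε, hball⟩ := Metric.mem_nhds_iff.1 hnb
  refine ⟨ε / 2, by positivity, ?_⟩
  have : (ε / 2) ∈ Metric.ball (0 : ℝ) ε := by
    rw [Metric.mem_ball, Real.dist_eq, sub_zero, abs_of_pos (by positivity)]
    linarith
  exact hball this

/-- If a relative interior point `x` of `G` lies in the extreme set `F`, every point of `P` in the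
affine span of `G` lies in `F`. -/
theorem mem_face_of_span {d : ℕ} {P F G : Set (Euc d)} {x y : Euc d} (hF : IsExtreme ℝ P F)
    (hG : G ⊆ P) (hx : x ∈ intrinsicInterior ℝ G) (hxF : x ∈ F) (hy : y ∈ P)
    (hyG : y ∈ affineSpan ℝ G) : y ∈ F := by
  obtain ⟨ε, hε, hz⟩ := exists_push hx hyG
  refine hF.left_mem_of_mem_openSegment hy (hG hz) hxF ?_
  refine ⟨ε / (1 + ε), 1 / (1 + ε), by positivity, by positivity, by field_simp; ring, ?_⟩
  have h1 : (1 + ε) ≠ 0 := by positivity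
  have : (1 + ε) • ((ε / (1 + ε)) • y + (1 / (1 + ε)) • (x + ε • (x - y))) = (1 + ε) • x := by
    rw [smul_add, smul_smul, smul_smul, mul_div_cancel₀ _ h1, mul_div_cancel₀ _ h1]
    module
  exact smul_right_injective _ h1 this

/-- Faces of polytopes are exposed. -/
theorem exists_exposing {d : ℕ} (W : Finset (Euc d)) {F : Set (Euc d)}
    (hF : IsFace (convexHull ℝ (W : Set (Euc d))) F) {p : Euc d}
    (hp : p ∈ intrinsicInterior ℝ F) :
    ∃ (l : Euc d →L[ℝ] ℝ) (c : ℝ), (∀ x ∈ F, c - l x = 0) ∧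
      ∀ x ∈ convexHull ℝ (W : Set (Euc d)), x ∈ F ∨ 0 < c - l x := by
  obtain ⟨-, -, hconv, hext⟩ := hF
  have hpF : p ∈ F := intrinsicInterior_subset hp
  set P := convexHull ℝ (W : Set (Euc d)) with hP
  have hdiff : convexHull ℝ ((W : Set (Euc d)) \ F) ⊆ P \ F :=
    convexHull_min (fun x hx => ⟨subset_convexHull ℝ _ hx.1, hx.2⟩)
      (hext.convex_sdiff (convex_convexHull ℝ _))
  have hdisj : Disjoint (convexHull ℝ ((W : Set (Euc d)) \ F)) (affineSpan ℝ F : Set (Euc d)) := by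
    rw [Set.disjoint_left]
    intro x hx hxF
    exact (hdiff hx).2 (mem_face_of_span hext hext.subset hp hpF (hdiff hx).1 hxF)
  obtain ⟨l, u, v, hlu, huv, hlv⟩ := geometric_hahn_banach_compact_closed
    (convex_convexHull ℝ _) ((W.finite_toSet.subset sdiff_subset).isCompact_convexHull ℝ)
    (affineSpan ℝ F).convex (AffineSubspace.closed_of_finiteDimensional _) hdisj
  have hpS : p ∈ affineSpan ℝ F := subset_affineSpan ℝ F hpF
  have hzero : ∀ x ∈ F, l p - l x = 0 := by
    intro x hx
    by_contra hne
    have hmem : ((v - l p - 1) / (l x - l p)) • (x - p) + p ∈ affineSpan ℝ F := by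
      have h := AffineSubspace.smul_vsub_vadd_mem (affineSpan ℝ F)
        ((v - l p - 1) / (l x - l p)) (subset_affineSpan ℝ F hx) hpS hpS
      simpa using h
    have h := hlv _ hmem
    have h2 : l x - l p ≠ 0 := fun h => hne (by linarith)
    rw [map_add, map_smul, map_sub, smul_eq_mul, div_mul_cancel₀ _ h2] at h
    linarith
  refine ⟨l, l p, hzero, ?_⟩
  let Q : Set (Euc d) := {x | x ∈ F ∨ 0 < l p - l x}
  have hQ0 : ∀ x ∈ Q, 0 ≤ l p - l x := by
    rintro x (hx | hx)
    · exact (hzero x hx).ge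
    · exact hx.le
  have hQ : Convex ℝ Q := by
    intro x hx y hy a b ha hb hab
    have key : l p - l (a • x + b • y) = a * (l p - l x) + b * (l p - l y) := by
      simp only [map_add, map_smul, smul_eq_mul]
      linear_combination (-(l p)) * hab
    rcases ha.eq_or_lt with rfl | ha
    · obtain rfl : b = 1 := by linarith
      simpa using hy
    rcases hb.eq_or_lt with rfl | hb
    · obtain rfl : a = 1 := by linarith
      simpa using hx
    have h1 := hQ0 x hx
    have h2 := hQ0 y hy
    by_cases hxp : 0 < l p - l x
    · right
      rw [key]
      positivity
    by_cases hyp : 0 < l p - l y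
    · right
      rw [key]
      positivity
    · exact Or.inl (hconv (hx.resolve_right hxp) (hy.resolve_right hyp) ha.le hb.le hab)
  have hWQ : (W : Set (Euc d)) ⊆ Q := by
    intro x hx
    by_cases hxF : x ∈ F
    · exact Or.inl hxF
    · right
      have h1 := hlu x (subset_convexHull ℝ _ ⟨hx, hxF⟩)
      have h2 := hlv p hpS
      linarith
  exact fun x hx => convexHull_min hWQ hQ hx

/-- Key lemma: if `v i` is a positive combination of `w 0, …, w i`, then the simplex of `v` is a flag
simplex of the simplex of `w`. -/
theorem flag_of_triangular {d : ℕ} (v w : Fin (d + 1) → Euc d) (hv : AffineIndependent ℝ v)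
    (c : Fin (d + 1) → Fin (d + 1) → ℝ) (hpos : ∀ i j, j ≤ i → 0 < c i j)
    (hzero : ∀ i j, i < j → c i j = 0) (hsum : ∀ i, ∑ j, c i j = 1)
    (hcomb : ∀ i, v i = ∑ j, c i j • w j) :
    AffineIndependent ℝ w ∧
      IsFlagSimplex d (convexHull ℝ (Set.range w)) (convexHull ℝ (Set.range v)) := by
  have hvtop : affineSpan ℝ (Set.range v) = ⊤ := by
    rw [hv.affineSpan_eq_top_iff_card_eq_finrank_add_one]
    simp
  have hwtop : affineSpan ℝ (Set.range w) = ⊤ := by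
    rw [← top_le_iff, ← hvtop, affineSpan_le]
    rintro _ ⟨i, rfl⟩
    have h := affineCombination_mem_affineSpan (hsum i) w
    rw [Finset.affineCombination_eq_linear_combination _ _ _ (hsum i), ← hcomb] at h
    exact h
  have hw : AffineIndependent ℝ w := by
    rw [affineIndependent_iff_finrank_vectorSpan_eq ℝ w (n := d) (by simp),
      ← direction_affineSpan, hwtop, AffineSubspace.direction_top, finrank_top,
      finrank_euclideanSpace_fin]
  refine ⟨hw, ?_⟩
  let b : AffineBasis (Fin (d + 1)) ℝ (Euc d) := ⟨w, hw, hwtop⟩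
  have hb : ∀ i, b i = w i := fun _ => rfl
  have hrange : convexHull ℝ (Set.range w) = {x | ∀ i, 0 ≤ b.coord i x} :=
    b.convexHull_eq_nonneg_coord
  let f : Fin (d + 1) → Set (Euc d) := fun i => convexHull ℝ (w '' Set.Iic i)
  have hspan : ∀ i j, i < j → ∀ x ∈ affineSpan ℝ (f i), b.coord j x = 0 := by
    intro i j hij x hx
    rw [affineSpan_convexHull] at hx
    have hle : affineSpan ℝ (w '' Set.Iic i) ≤
        (affineSpan ℝ ({0} : Set ℝ)).comap (b.coord j) := by
      rw [affineSpan_le]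
      rintro _ ⟨k, hk, rfl⟩
      have : b.coord j (w k) = 0 := b.coord_apply_ne (ne_of_gt (lt_of_le_of_lt hk hij))
      simp [this]
    simpa using hle hx
  have hf : ∀ i, f i = {x | (∀ j, 0 ≤ b.coord j x) ∧ ∀ j, i < j → b.coord j x = 0} := by
    intro i
    ext x
    constructor
    · intro hx
      refine ⟨?_, fun j hj => hspan i j hj x (subset_affineSpan ℝ _ hx)⟩
      have : x ∈ convexHull ℝ (Set.range w) := convexHull_mono (Set.image_subset_range _ _) hx
      rw [hrange] at this
      exact this
    · rintro ⟨h0, h1⟩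
      have hs := b.sum_coord_apply_eq_one x
      have hc := b.linear_combination_coord_eq_self x
      have e1 : ∑ j ∈ Finset.Iic i, b.coord j x = 1 := by
        rw [← hs]
        apply Finset.sum_subset (Finset.subset_univ _)
        intro j _ hj
        exact h1 j (by simpa using hj)
      have e2 : ∑ j ∈ Finset.Iic i, b.coord j x • w j = x := by
        refine Eq.trans ?_ hc
        apply Finset.sum_subset (Finset.subset_univ _)
        intro j _ hj
        rw [h1 j (by simpa using hj), zero_smul]
      rw [← e2]
      refine (convex_convexHull ℝ _).sum_mem (fun j _ => h0 j) e1 ?_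
      intro j hj
      exact subset_convexHull ℝ _ ⟨j, by simpa using hj, rfl⟩
  refine ⟨f, ⟨?_, ?_⟩, v, hv, rfl, ?_⟩
  · intro i
    refine ⟨⟨?_, ?_, convex_convexHull ℝ _, ?_⟩, ?_⟩
    · exact ⟨w i, subset_convexHull ℝ _ ⟨i, le_refl i, rfl⟩⟩
    · exact ((Set.toFinite _).isCompact_convexHull ℝ).isClosed
    · refine ⟨convexHull_mono (Set.image_subset_range _ _), ?_⟩
      rintro x hx y hy z hz ⟨s, t, hs, ht, hst, rfl⟩
      rw [hf] at hz ⊢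
      rw [hrange] at hx hy
      refine ⟨hx, fun j hj => ?_⟩
      have h := hz.2 j hj
      rw [Convex.combo_affine_apply hst, smul_eq_mul, smul_eq_mul] at h
      have h1 := mul_nonneg hs.le (hx j)
      have h2 := mul_nonneg ht.le (hy j)
      have h3 : s * b.coord j x = 0 := by linarith
      exact (mul_eq_zero.1 h3).resolve_left hs.ne'
    · unfold faceDim
      rw [affineSpan_convexHull, direction_affineSpan]
      have h := hw.finrank_vectorSpan_image_finset (s := Finset.Iic i) (n := (i : ℕ)) (by simp)
      rw [Finset.coe_image, Finset.coe_Iic] at h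
      exact h
  · intro i j hij
    exact convexHull_mono (Set.image_mono (Set.Iic_subset_Iic.2 hij))
  · intro i
    have hcoord : ∀ j, b.coord j (v i) = c i j := by
      intro j
      have h := b.coord_apply_combination_of_mem (Finset.mem_univ j) (hsum i)
      rw [Finset.affineCombination_eq_linear_combination _ _ _ (hsum i)] at h
      rw [hcomb i]
      exact h
    have hvi : v i ∈ f i := by
      rw [hf]
      refine ⟨fun j => ?_, fun j hj => ?_⟩
      · rw [hcoord]
        rcases le_or_gt j i with h | h
        · exact (hpos i j h).le
        · exact (hzero i j h).ge
      · rw [hcoord, hzero i j hj]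
    rw [mem_intrinsicInterior]
    refine ⟨⟨v i, subset_affineSpan ℝ _ hvi⟩, ?_, rfl⟩
    rw [mem_interior]
    refine ⟨⋂ j ∈ Finset.Iic i, {y : affineSpan ℝ (f i) | 0 < b.coord j (y : Euc d)}, ?_, ?_, ?_⟩
    · intro y hy
      simp only [Set.mem_iInter, Finset.mem_Iic, Set.mem_ofPred_eq] at hy
      change (y : Euc d) ∈ f i
      refine (Set.ext_iff.1 (hf i) y).2 ⟨fun j => ?_, fun j hj => hspan i j hj y y.2⟩
      rcases le_or_gt j i with h | h
      · exact (hy j h).le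
      · exact (hspan i j h y y.2).ge
    · apply isOpen_biInter_finset
      intro j _
      exact isOpen_lt continuous_const
        ((continuous_barycentric_coord b j).comp continuous_subtype_val)
    · simp only [Set.mem_iInter, Finset.mem_Iic, Set.mem_ofPred_eq]
      intro j hj
      rw [hcoord]
      exact hpos i j hj

/-- The inner simplex. -/
theorem exists_inner {d : ℕ} (v : Fin (d + 1) → Euc d) (hv : AffineIndependent ℝ v)
    (f : Fin (d + 1) → Set (Euc d)) (hconv : ∀ i, Convex ℝ (f i))
    (hmono : ∀ i j, i ≤ j → f i ⊆ f j) (hvf : ∀ i, v i ∈ intrinsicInterior ℝ (f i)) :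
    ∃ w : Fin (d + 1) → Euc d, AffineIndependent ℝ w ∧ (∀ i, w i ∈ f i) ∧
      IsFlagSimplex d (convexHull ℝ (Set.range w)) (convexHull ℝ (Set.range v)) := by
  have hstep : ∀ i, ∃ (u : Euc d) (α β : ℝ), u ∈ f i ∧ 0 < α ∧ 0 < β ∧
      α + (i : ℕ) * β = 1 ∧ v i = α • u + β • ∑ j ∈ Finset.Iio i, v j := by
    intro i
    let n : ℝ := ((i : ℕ) : ℝ) + 1
    have hn : 0 < n := by positivity
    let y : Euc d := ∑ j ∈ Finset.Iic i, (1 / n) • v j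
    have hy : y ∈ f i := by
      refine (hconv i).sum_mem (fun j _ => by positivity) ?_ ?_
      · simp [n]
        field_simp
      · intro j hj
        exact hmono j i (by simpa using hj) (intrinsicInterior_subset (hvf j))
    obtain ⟨ε, hε, hu⟩ := exists_push (hvf i) (subset_affineSpan ℝ _ hy)
    have hy' : y = (1 / n) • (v i + ∑ j ∈ Finset.Iio i, v j) := by
      change ∑ j ∈ Finset.Iic i, (1 / n) • v j = _
      rw [← Finset.smul_sum]
      congr 1
      rw [← Finset.Iio_insert, Finset.sum_insert (by simp)]
    have hD : 0 < n + ε * (n - 1) := by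
      have : 0 ≤ n - 1 := by simp [n]
      positivity
    refine ⟨_, n / (n + ε * (n - 1)), ε / (n + ε * (n - 1)), hu, by positivity, by positivity, ?_, ?_⟩
    · have : ((i : ℕ) : ℝ) = n - 1 := by simp [n]
      rw [this]
      field_simp
    · rw [hy']
      generalize ∑ j ∈ Finset.Iio i, v j = s
      match_scalars <;> field_simp <;> ring
  choose u α β huf hα hβ hαβ hvu using hstep
  have hc : ∀ i, ∃ c : Fin (d + 1) → ℝ, (∀ j, j ≤ i → 0 < c j) ∧ (∀ j, i < j → c j = 0) ∧
      ∑ j, c j = 1 ∧ v i = ∑ j, c j • u j := by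
    intro i
    induction i using WellFoundedLT.induction with
    | ind i ih =>
      choose! c h1 h2 h3 h4 using ih
      refine ⟨fun j => (if j = i then α i else 0) + β i * ∑ k ∈ Finset.Iio i, c k j, ?_, ?_, ?_, ?_⟩
      · intro j hj
        have hnn : ∀ k ∈ Finset.Iio i, 0 ≤ c k j := by
          intro k hk
          rw [Finset.mem_Iio] at hk
          rcases le_or_gt j k with h | h
          · exact (h1 k hk j h).le
          · exact (h2 k hk j h).ge
        rcases hj.eq_or_lt with rfl | hlt
        · have := mul_nonneg (hβ j).le (Finset.sum_nonneg hnn)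
          have := hα j
          simp only [if_true]
          linarith
        · have : 0 < ∑ k ∈ Finset.Iio i, c k j :=
            Finset.sum_pos' hnn ⟨j, by simpa using hlt, h1 j hlt j le_rfl⟩
          simp only [if_neg hlt.ne, zero_add]
          exact mul_pos (hβ i) this
      · intro j hj
        simp only [if_neg hj.ne', zero_add]
        rw [Finset.sum_eq_zero, mul_zero]
        intro k hk
        rw [Finset.mem_Iio] at hk
        exact h2 k hk j (hk.trans hj)
      · rw [Finset.sum_add_distrib, ← Finset.mul_sum, Finset.sum_comm,
          Finset.sum_congr rfl (fun k hk => h3 k (Finset.mem_Iio.1 hk))]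
        simp only [Finset.sum_ite_eq', Finset.mem_univ, if_true, Finset.sum_const, Fin.card_Iio,
          nsmul_eq_mul, mul_one]
        rw [← hαβ i]
        ring
      · conv_lhs => rw [hvu i, Finset.sum_congr rfl (fun k hk => h4 k (Finset.mem_Iio.1 hk))]
        simp only [add_smul, Finset.sum_add_distrib, ite_smul, zero_smul, Finset.sum_ite_eq',
          Finset.mem_univ, if_true, mul_smul, Finset.sum_smul]
        rw [← Finset.smul_sum, Finset.sum_comm]
  choose c h1 h2 h3 h4 using hc
  obtain ⟨h, h'⟩ := flag_of_triangular v u hv c h1 h2 h3 h4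
  exact ⟨u, h, huf, h'⟩

/-- The outer simplex, from a triangular system of affine functions. -/
theorem exists_outer {d : ℕ} (v : Fin (d + 1) → Euc d) (hv : AffineIndependent ℝ v)
    (P : Set (Euc d)) (g : Fin (d + 1) → Euc d →ᵃ[ℝ] ℝ) (hg1 : ∀ x, ∑ j, g j x = 1)
    (hgP : ∀ x ∈ P, ∀ j, 0 ≤ g j x) (hpos : ∀ i j, j ≤ i → 0 < g j (v i))
    (hzero : ∀ i j, i < j → g j (v i) = 0) :
    ∃ w : Fin (d + 1) → Euc d, AffineIndependent ℝ w ∧ P ⊆ convexHull ℝ (Set.range w) ∧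
      IsFlagSimplex d (convexHull ℝ (Set.range w)) (convexHull ℝ (Set.range v)) := by
  let M : Matrix (Fin (d + 1)) (Fin (d + 1)) ℝ := Matrix.of fun i j => g j (v i)
  have hdet : M.det ≠ 0 := by
    rw [Matrix.det_of_lowerTriangular M (fun i j hij => hzero i j hij)]
    exact Finset.prod_ne_zero_iff.2 (fun i _ => (hpos i i le_rfl).ne')
  have hMN : M * M⁻¹ = 1 := Matrix.mul_nonsing_inv M (isUnit_iff_ne_zero.2 hdet)
  have hNM : M⁻¹ * M = 1 := Matrix.nonsing_inv_mul M (isUnit_iff_ne_zero.2 hdet)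
  let w : Fin (d + 1) → Euc d := fun k => ∑ i, M⁻¹ k i • v i
  have hM1 : ∀ i, ∑ j, M i j = 1 := fun i => hg1 (v i)
  have hN1 : ∀ k, ∑ i, M⁻¹ k i = 1 := by
    intro k
    have h : ∀ i, M⁻¹ k i = ∑ j, M⁻¹ k i * M i j := by
      intro i
      rw [← Finset.mul_sum, hM1, mul_one]
    rw [Finset.sum_congr rfl (fun i _ => h i), Finset.sum_comm]
    have h2 : ∀ j, ∑ i, M⁻¹ k i * M i j = if k = j then 1 else 0 := by
      intro j
      rw [← Matrix.one_apply, ← hNM, Matrix.mul_apply]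
    rw [Finset.sum_congr rfl (fun j _ => h2 j)]
    simp
  have hcomb : ∀ i, v i = ∑ j, M i j • w j := by
    intro i
    simp only [w, Finset.smul_sum, smul_smul]
    rw [Finset.sum_comm]
    simp only [← Finset.sum_smul]
    have h2 : ∀ k, ∑ j, M i j * M⁻¹ j k = (1 : Matrix (Fin (d + 1)) (Fin (d + 1)) ℝ) i k := by
      intro k
      rw [← hMN, Matrix.mul_apply]
    rw [Finset.sum_congr rfl (fun k _ => by rw [h2 k])]
    simp [Matrix.one_apply]
  have haff : ∀ (a : Fin (d + 1) → ℝ) (p : Fin (d + 1) → Euc d) (j : Fin (d + 1)),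
      ∑ k, a k = 1 → g j (∑ k, a k • p k) = ∑ k, a k * g j (p k) := by
    intro a p j ha
    rw [← Finset.affineCombination_eq_linear_combination _ _ _ ha, Finset.map_affineCombination _ _ _ ha,
      Finset.affineCombination_eq_linear_combination _ _ _ ha]
    simp
  have hgw : ∀ j k, g j (w k) = if k = j then 1 else 0 := by
    intro j k
    rw [haff _ _ _ (hN1 k), ← Matrix.one_apply, ← hNM, Matrix.mul_apply]
    rfl
  obtain ⟨hw, hflag⟩ := flag_of_triangular v w hv M hpos hzero hM1 hcomb
  refine ⟨w, hw, ?_, hflag⟩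
  have hwtop : affineSpan ℝ (Set.range w) = ⊤ := by
    rw [hw.affineSpan_eq_top_iff_card_eq_finrank_add_one]
    simp
  let b : AffineBasis (Fin (d + 1)) ℝ (Euc d) := ⟨w, hw, hwtop⟩
  have hrange : convexHull ℝ (Set.range w) = {x | ∀ i, 0 ≤ b.coord i x} :=
    b.convexHull_eq_nonneg_coord
  rw [hrange]
  intro x hx j
  have hxs : ∑ k, b.coord k x • w k = x := b.linear_combination_coord_eq_self x
  have h := haff (fun k => b.coord k x) w j (b.sum_coord_apply_eq_one x)
  rw [hxs] at h
  simp only [hgw, mul_ite, mul_one, mul_zero, Finset.sum_ite_eq', Finset.mem_univ, if_true] at h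
  rw [← h]
  exact hgP x hx j

/-- For a flag simplex `S` of a `d`-dimensional polytope `P ⊆ ℝ^d`, there exist
`d`-simplices `U ⊆ P ⊆ V` such that `S` is a flag simplex of both `U` and `V`. -/
theorem exists_bounding_simplices (d : ℕ) (W : Finset (Euc d)) (hW : W.Nonempty)
    (P : Set (Euc d)) (hP : P = convexHull ℝ (W : Set (Euc d))) (hdim : faceDim P = d)
    (S : Set (Euc d)) (hS : IsFlagSimplex d P S) :
    ∃ U V : Set (Euc d), IsSimplexSet d U ∧ IsSimplexSet d V ∧
      U ⊆ P ∧ P ⊆ V ∧ IsFlagSimplex d U S ∧ IsFlagSimplex d V S := by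
  obtain ⟨f, ⟨hf, hmono⟩, v, hv, rfl, hvf⟩ := hS
  subst hP
  set P := convexHull ℝ (W : Set (Euc d)) with hP
  obtain ⟨u, hu, huf, hflagU⟩ := exists_inner v hv f (fun i => (hf i).1.2.2.1) hmono hvf
  have hvP : ∀ i, v i ∈ P := fun i => (hf i).1.2.2.2.subset (intrinsicInterior_subset (hvf i))
  have hnot : ∀ i j, i < j → v j ∉ f i := by
    intro i j hij hmem
    have hsub : f j ⊆ f i := fun y hy =>
      mem_face_of_span (hf i).1.2.2.2 (hf j).1.2.2.2.subset (hvf j) hmem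
        ((hf j).1.2.2.2.subset hy) (subset_affineSpan ℝ _ hy)
    have hle : faceDim (f j) ≤ faceDim (f i) :=
      Submodule.finrank_mono (AffineSubspace.direction_le (affineSpan_mono ℝ hsub))
    rw [(hf i).2, (hf j).2] at hle
    exact absurd hij (not_lt.2 hle)
  have hexp : ∀ k : Fin d, ∃ g : Euc d →ᵃ[ℝ] ℝ, (∀ x ∈ f k.castSucc, g x = 0) ∧
      ∀ x ∈ P, x ∈ f k.castSucc ∨ 0 < g x := by
    intro k
    obtain ⟨l, c, h1, h2⟩ := exists_exposing W (hf k.castSucc).1 (hvf k.castSucc)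
    exact ⟨AffineMap.const ℝ (Euc d) c - (l : Euc d →ₗ[ℝ] ℝ).toAffineMap, h1, h2⟩
  choose g hg0 hg1 using hexp
  have hg : ∀ k, ∀ x ∈ P, 0 ≤ g k x := fun k x hx =>
    (hg1 k x hx).elim (fun h => (hg0 k x h).ge) le_of_lt
  have hcomp : IsCompact P := W.finite_toSet.isCompact_convexHull ℝ
  have hcont : Continuous fun x => ∑ k, g k x :=
    continuous_finset_sum _ fun k _ => (g k).continuous_of_finiteDimensional
  obtain ⟨B, hB⟩ := (hcomp.image hcont).bddAbove
  have hB' : ∀ x ∈ P, ∑ k, g k x ≤ B := fun x hx => hB ⟨x, hx, rfl⟩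
  have hB0 : 0 ≤ B := (Finset.sum_nonneg fun k _ => hg k _ (hvP 0)).trans (hB' _ (hvP 0))
  let ε : ℝ := 1 / (B + 1)
  have hε : 0 < ε := by positivity
  have hεB : ε * B < 1 := by
    simp only [ε]
    rw [div_mul_eq_mul_div, div_lt_one (by linarith)]
    linarith
  let G : Fin (d + 1) → Euc d →ᵃ[ℝ] ℝ :=
    Fin.cons (AffineMap.const ℝ (Euc d) 1 - ε • ∑ k, g k) (fun k => ε • g k)
  have hG0 : ∀ x, G 0 x = 1 - ε * ∑ k, g k x := by
    intro x
    have : (∑ k, g k) x = ∑ k, g k x := by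
      have h := map_sum (⟨⟨fun q : Euc d →ᵃ[ℝ] ℝ => q x, rfl⟩, fun _ _ => rfl⟩ :
        (Euc d →ᵃ[ℝ] ℝ) →+ ℝ) g Finset.univ
      exact h
    simp [G, this]
  have hGs : ∀ k x, G (Fin.succ k) x = ε * g k x := fun k x => by simp [G]
  have hG0pos : ∀ x ∈ P, 0 < G 0 x := by
    intro x hx
    rw [hG0]
    have := mul_le_mul_of_nonneg_left (hB' x hx) hε.le
    linarith
  obtain ⟨w, hw, hPw, hflagV⟩ := exists_outer v hv P G
    (by
      intro x
      rw [Fin.sum_univ_succ, hG0]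
      simp only [hGs]
      rw [← Finset.mul_sum]
      ring)
    (by
      intro x hx j
      refine Fin.cases (hG0pos x hx).le (fun k => ?_) j
      rw [hGs]
      exact mul_nonneg hε.le (hg k x hx))
    (by
      intro i j
      refine Fin.cases (fun _ => hG0pos _ (hvP i)) (fun k hk => ?_) j
      rw [hGs]
      refine mul_pos hε ((hg1 k _ (hvP i)).resolve_left (hnot _ _ ?_))
      exact lt_of_lt_of_le k.castSucc_lt_succ hk)
    (by
      intro i j
      refine Fin.cases (fun h => absurd h (Fin.not_lt_zero i)) (fun k hk => ?_) j
      rw [hGs, hg0 k, mul_zero]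
      exact hmono i _ (Fin.le_castSucc_iff.2 hk) (intrinsicInterior_subset (hvf i)))
  refine ⟨_, _, ⟨u, hu, rfl⟩, ⟨w, hw, rfl⟩, ?_, hPw, hflagU, hflagV⟩
  refine convexHull_min ?_ (convex_convexHull ℝ _)
  rintro _ ⟨i, rfl⟩
  exact (hf i).1.2.2.2.subset (huf i)

end
end

section
/- For every d ≥ 1 and every 0 < l ≤ 1 there exists a polynomial p_{d,l} of degree d with the following property: for every d-dimensional polytope P ⊆ ℝ^d with l·B̄(0,1) ⊆ P ⊆ B̄(0,1) (B̄(0,1) the closed Euclidean unit ball), every facet F of P (a face of P of dimension d−1), and the cone L := {t·x : x ∈ F, 0 ≤ t ≤ 1}, one has Vol^H_{int P}(B_{int P}(0,R) ∩ L) ≤ p_{d,l}(R) · |Flags(F)| for all R ≥ 0, where Flags(F) is the set of maximal flags of F regarded as a (d−1)-dimensional polytope. -/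
open Filter Set MeasureTheory Metric
open scoped ENNReal Topology Pointwise RealInnerProductSpace

noncomputable section
open scoped Classical

lemma aux_exists_center {d : ℕ} (hd : 1 ≤ d) (K : Set (Euc d)) (hK : Convex ℝ K)
    (hc : IsCompact K) (hne : K.Nonempty) :
    ∃ c ∈ K, ∀ x ∈ K, c + (1 / (d : ℝ)) • (c - x) ∈ K := by
  have hd0 : (0 : ℝ) < d := by exact_mod_cast hd
  obtain ⟨x0, hx0⟩ := hne
  have key := Convex.helly_theorem_compact' (𝕜 := ℝ) (E := Euc d)
    (F := fun x : K => K ∩ {c | c + (1 / (d : ℝ)) • (c - (x : Euc d)) ∈ K}) ?_ ?_ ?_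
  · obtain ⟨c, hcm⟩ := key
    simp only [mem_iInter] at hcm
    exact ⟨c, (hcm ⟨x0, hx0⟩).1, fun x hx => (hcm ⟨x, hx⟩).2⟩
  · intro x u hu v hv a b ha hb hab
    refine ⟨hK hu.1 hv.1 ha hb hab, ?_⟩
    have := hK hu.2 hv.2 ha hb hab
    simp only [mem_ofPred_eq]
    convert this using 1
    have hx : (x : Euc d) = a • (x : Euc d) + b • (x : Euc d) := by rw [← add_smul, hab, one_smul]
    nth_rw 1 [hx]
    module
  · intro x
    refine hc.inter_right ?_
    exact hc.isClosed.preimage (by fun_prop)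
  · intro I hI
    rcases I.eq_empty_or_nonempty with rfl | hIne
    · exact ⟨x0, by simp⟩
    have hn : (0 : ℝ) < I.card := by exact_mod_cast hIne.card_pos
    have hn2 : (I.card : ℝ) ≤ d + 1 := by
      have : Module.finrank ℝ (Euc d) = d := by simp
      rw [this] at hI
      exact_mod_cast hI
    refine ⟨∑ i ∈ I, (1 / (I.card : ℝ)) • (i : Euc d), ?_⟩
    simp only [mem_iInter]
    intro j hj
    refine ⟨hK.sum_mem (fun i _ => by positivity) ?_ (fun i _ => i.2), ?_⟩
    · rw [Finset.sum_const, nsmul_eq_mul]; field_simp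
    · simp only [mem_ofPred_eq]
      have e : (∑ i ∈ I, (1 / (I.card : ℝ)) • (i : Euc d)) + (1 / (d : ℝ)) •
          ((∑ i ∈ I, (1 / (I.card : ℝ)) • (i : Euc d)) - (j : Euc d)) =
          ∑ i ∈ I, ((1 / (I.card : ℝ)) * (1 + 1 / d) - if i = j then 1 / (d : ℝ) else 0)
            • (i : Euc d) := by
        simp only [sub_smul, Finset.sum_sub_distrib, ite_smul, zero_smul, Finset.sum_ite_eq', hj,
          if_true, mul_comm (1 / (I.card : ℝ)) (1 + 1 / d), mul_smul, ← Finset.smul_sum]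
        module
      rw [e]
      refine hK.sum_mem ?_ ?_ (fun i _ => i.2)
      · intro i _
        have : 1 / (d : ℝ) ≤ (1 / (I.card : ℝ)) * (1 + 1 / d) := by
          rw [one_div_mul_eq_div, div_le_div_iff₀ hd0 hn]
          field_simp; linarith
        have h0 : 0 < 1 / (d : ℝ) := by positivity
        split_ifs <;> linarith
      · rw [Finset.sum_sub_distrib, Finset.sum_const, nsmul_eq_mul, Finset.sum_ite_eq', if_pos hj]
        field_simp; ring

lemma aux_extreme_eq {d : ℕ} (W : Set (Euc d)) (B : Set (Euc d)) (hB : Convex ℝ B)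
    (hE : IsExtreme ℝ (convexHull ℝ W) B) : B = convexHull ℝ (W ∩ B) := by
  apply Subset.antisymm
  · intro x hx
    have hsd := hE.convex_sdiff (convex_convexHull ℝ W)
    have h2 : convexHull ℝ (W \ B) ⊆ convexHull ℝ W \ B :=
      convexHull_min (fun w hw => ⟨subset_convexHull ℝ W hw.1, hw.2⟩) hsd
    have h1 : convexHull ℝ (W ∩ B) ⊆ B := convexHull_min inter_subset_right hB
    have hxW := hE.subset hx
    rw [← inter_union_sdiff W B] at hxW
    rcases (W ∩ B).eq_empty_or_nonempty with h | h
    · rw [h, empty_union] at hxW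
      exact absurd hx (h2 hxW).2
    rcases (W \ B).eq_empty_or_nonempty with h' | h'
    · rwa [h', union_empty] at hxW
    rw [convexHull_union h h', mem_convexJoin] at hxW
    obtain ⟨u, hu, v, hv, hs⟩ := hxW
    rw [← insert_endpoints_openSegment] at hs
    rcases hs with rfl | rfl | hs
    · exact hu
    · exact absurd hx (h2 hv).2
    · exact absurd (hE.right_mem_of_mem_openSegment (hE.subset (h1 hu)) (h2 hv).1 hx hs)
        (h2 hv).2
  · exact convexHull_min inter_subset_right hB

lemma aux_extreme_closed {d : ℕ} (W : Finset (Euc d)) (B : Set (Euc d)) (hB : Convex ℝ B)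
    (hE : IsExtreme ℝ (convexHull ℝ (W : Set (Euc d))) B) : IsCompact B := by
  rw [aux_extreme_eq _ B hB hE]
  exact (W.finite_toSet.inter_of_left B).isCompact_convexHull ℝ

lemma aux_faces_finite {d : ℕ} (W : Finset (Euc d)) :
    {G : Set (Euc d) | IsFace (convexHull ℝ (W : Set (Euc d))) G}.Finite := by
  refine ((W.finite_toSet.finite_subsets).image (fun S => convexHull ℝ S)).subset ?_
  rintro G ⟨-, -, hc, he⟩
  exact ⟨(W : Set (Euc d)) ∩ G, inter_subset_left, (aux_extreme_eq _ G hc he).symm⟩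

lemma aux_dim_lt {d : ℕ} (A B : Set (Euc d)) (hB : Convex ℝ B)
    (hne : B.Nonempty) (hE : IsExtreme ℝ A B) (hAB : B ≠ A) : faceDim B < faceDim A := by
  have hle : affineSpan ℝ B ≤ affineSpan ℝ A := affineSpan_mono ℝ hE.subset
  have hdl := AffineSubspace.direction_le hle
  refine lt_of_le_of_ne (Submodule.finrank_mono hdl) ?_
  intro heq
  have hdir := Submodule.eq_of_le_of_finrank_eq hdl heq
  have hspan : affineSpan ℝ B = affineSpan ℝ A :=
    AffineSubspace.eq_of_direction_eq_of_nonempty_of_le hdir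
      ((affineSpan_nonempty (k := ℝ)).2 hne) hle
  apply hAB
  refine Subset.antisymm hE.subset ?_
  intro z hz
  obtain ⟨x, hx⟩ := Set.Nonempty.intrinsicInterior hB hne
  rw [mem_intrinsicInterior] at hx
  obtain ⟨⟨x', hx'⟩, hxi, rfl⟩ := hx
  have hzs : z ∈ affineSpan ℝ B := by rw [hspan]; exact subset_affineSpan ℝ A hz
  let f : ℝ → affineSpan ℝ B := fun τ => ⟨AffineMap.lineMap x' z τ,
    AffineMap.lineMap_mem τ hx' hzs⟩
  have hf : Continuous f := by
    refine Continuous.subtype_mk ?_ _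
    exact AffineMap.lineMap_continuous
  have hf0 : f 0 = ⟨x', hx'⟩ := by simp [f]
  have hev : ∀ᶠ τ in 𝓝 (0 : ℝ), f τ ∈ interior ((↑) ⁻¹' B : Set (affineSpan ℝ B)) :=
    hf.continuousAt.eventually_mem (by rw [hf0]; exact isOpen_interior.mem_nhds hxi)
  obtain ⟨ε, hε, hball⟩ := Metric.eventually_nhds_iff.1 hev
  have hmem := hball (y := -(ε / 2)) (by rw [Real.dist_eq, sub_zero, abs_neg, abs_of_pos (by linarith)]; linarith)
  have hm2 : AffineMap.lineMap x' z (-(ε / 2)) ∈ B := (interior_subset hmem : f (-(ε / 2)) ∈ ((↑) ⁻¹' B : Set (affineSpan ℝ B)))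
  have hxB : x' ∈ B := (interior_subset hxi : (⟨x', hx'⟩ : affineSpan ℝ B) ∈ ((↑) ⁻¹' B : Set (affineSpan ℝ B)))
  refine hE.left_mem_of_mem_openSegment hz (hE.subset hm2) hxB ?_
  refine ⟨(ε / 2) / (1 + ε / 2), 1 / (1 + ε / 2), by positivity, by positivity, ?_, ?_⟩
  · field_simp
    ring
  · rw [AffineMap.lineMap_apply_module']
    have : (1 + ε / 2) ≠ 0 := by positivity
    have e1 : x' = ((ε / 2) / (1 + ε / 2) + 1 / (1 + ε / 2)) • x' := by
      rw [← add_div, add_comm, div_self this, one_smul]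
    conv_rhs => rw [e1]
    match_scalars <;> field_simp <;> ring

lemma aux_subface {d : ℕ} (W : Finset (Euc d)) (G : Set (Euc d))
    (hG : IsFace (convexHull ℝ (W : Set (Euc d))) G) (c y : Euc d) (hc : c ∈ G) (hy : y ∈ G)
    (hcy : y ≠ c) :
    ∃ G', IsFace (convexHull ℝ (W : Set (Euc d))) G' ∧ G' ⊆ G ∧ faceDim G' < faceDim G ∧
      ∃ y' ∈ G', ∃ s : ℝ, 0 ≤ s ∧ s ≤ 1 ∧ y = c + s • (y' - c) := by
  obtain ⟨-, hcl, hconv, hext⟩ := hG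
  have hcomp := aux_extreme_closed W G hconv hext
  -- the exit time
  have hv : y - c ≠ 0 := sub_ne_zero.2 hcy
  have hTc : IsCompact {T : ℝ | c + T • (y - c) ∈ G} := by
    rw [Metric.isCompact_iff_isClosed_bounded]
    refine ⟨hcl.preimage (f := fun T : ℝ => c + T • (y - c)) (by fun_prop), ?_⟩
    obtain ⟨M, hM⟩ := hcomp.isBounded.exists_norm_le
    refine (Metric.isBounded_closedBall (x := (0 : ℝ)) (r := (M + ‖c‖) / ‖y - c‖)).subset ?_
    intro T hT
    rw [mem_closedBall_zero_iff, le_div_iff₀ (norm_pos_iff.2 hv), ← norm_smul]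
    have h1 := hM _ hT
    have h2 := norm_sub_le (c + T • (y - c)) c
    rw [add_sub_cancel_left] at h2
    linarith
  obtain ⟨T, hTG, hTmax⟩ := hTc.exists_isGreatest ⟨1, by simpa using hy⟩
  have hT1 : 1 ≤ T := hTmax (show (1 : ℝ) ∈ {T : ℝ | c + T • (y - c) ∈ G} by simpa using hy)
  set y' := c + T • (y - c) with hy'
  have hTG' : y' ∈ G := hTG
  let G' : Set (Euc d) := {z | z ∈ G ∧ ∃ ε : ℝ, 0 < ε ∧ y' + ε • (y' - z) ∈ G}
  have hyGmem : y' ∈ G' := ⟨hTG', 1, one_pos, by simpa using hTG'⟩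
  have hGsub : G' ⊆ G := fun z hz => hz.1
  have hGconv : Convex ℝ G' := by
    rintro z1 ⟨h1, e1, he1, g1⟩ z2 ⟨h2, e2, he2, g2⟩ a b ha hb hab
    refine ⟨hconv h1 h2 ha hb hab, min e1 e2, lt_min he1 he2, ?_⟩
    have shrink : ∀ (z : Euc d) (e e' : ℝ), 0 < e → 0 ≤ e' → e' ≤ e → y' + e • (y' - z) ∈ G →
        y' + e' • (y' - z) ∈ G := by
      intro z e e' he he' hle hg
      have := hconv.add_smul_mem hTG' hg (t := e' / e) ⟨by positivity, (div_le_one he).2 hle⟩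
      rwa [smul_smul, div_mul_cancel₀ _ he.ne'] at this
    have k1 := shrink z1 e1 (min e1 e2) he1 (lt_min he1 he2).le (min_le_left _ _) g1
    have k2 := shrink z2 e2 (min e1 e2) he2 (lt_min he1 he2).le (min_le_right _ _) g2
    have := hconv k1 k2 ha hb hab
    convert this using 1
    have hb' : b = 1 - a := by linarith
    subst hb'
    module
  have hGext : IsExtreme ℝ G G' := by
    refine ⟨hGsub, ?_⟩
    rintro x hx w hw z ⟨hz, e, he, hg⟩ ⟨a, b, ha, hb, hab, rfl⟩
    refine ⟨hx, e * a / (1 + e * b), by positivity, ?_⟩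
    have := hconv hg hw (a := 1 / (1 + e * b)) (b := e * b / (1 + e * b)) (by positivity)
      (by positivity) (by rw [← add_div]; exact div_self (by positivity))
    convert this using 1
    have hb' : a = 1 - b := by linarith
    subst hb'
    have : 1 + e * b ≠ 0 := by positivity
    match_scalars <;> field_simp <;> ring
  have hne : G' ≠ G := by
    intro h
    have : c ∈ G' := by rw [h]; exact hc
    obtain ⟨-, e, he, hg⟩ := this
    have h2 : (1 + e) * T ∈ {T : ℝ | c + T • (y - c) ∈ G} := by
      simp only [mem_ofPred_eq]
      convert hg using 1
      rw [hy']; module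
    have := hTmax h2
    nlinarith
  have hEP := hext.trans hGext
  refine ⟨G', ⟨⟨y', hyGmem⟩, (aux_extreme_closed W G' hGconv hEP).isClosed, hGconv, hEP⟩, hGsub,
    aux_dim_lt G G' hGconv ⟨y', hyGmem⟩ hGext hne, y', hyGmem, 1 / T, by positivity, ?_, ?_⟩
  · rw [div_le_one (by linarith)]; exact hT1
  · rw [hy', add_sub_cancel_left, smul_smul, one_div, inv_mul_cancel₀ (by linarith), one_smul]
    abel

lemma aux_span {d : ℕ} (W : Finset (Euc d)) (c : Set (Euc d) → Euc d)
    (hc : ∀ G, IsFace (convexHull ℝ (W : Set (Euc d))) G → c G ∈ G) (n : ℕ) :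
    ∀ G, IsFace (convexHull ℝ (W : Set (Euc d))) G → faceDim G = n → ∀ y ∈ G,
      ∃ S : Finset (Set (Euc d)), (∀ h ∈ S, IsFace (convexHull ℝ (W : Set (Euc d))) h) ∧
        S.card ≤ n + 1 ∧ y ∈ Submodule.span ℝ (c '' (S : Set (Set (Euc d)))) := by
  induction n using Nat.strong_induction_on with
  | _ n ih =>
    intro G hG hn y hy
    by_cases hyc : y = c G
    · exact ⟨{G}, by simpa using hG, by simp, by
        rw [hyc]; exact Submodule.subset_span (by simp)⟩
    · obtain ⟨G', hG', -, hlt, y', hy', s, -, -, rfl⟩ :=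
        aux_subface W G hG (c G) y (hc G hG) hy hyc
      obtain ⟨S, hS, hcard, hspan⟩ := ih (faceDim G') (hn ▸ hlt) G' hG' rfl y' hy'
      refine ⟨insert G S, ?_, ?_, ?_⟩
      · intro h hh
        rcases Finset.mem_insert.1 hh with rfl | hh
        · exact hG
        · exact hS h hh
      · have := Finset.card_insert_le G S
        omega
      · have h1 : c G ∈ Submodule.span ℝ (c '' ((insert G S : Finset _) : Set (Set (Euc d)))) :=
          Submodule.subset_span ⟨G, by simp, rfl⟩
        have h2 : y' ∈ Submodule.span ℝ (c '' ((insert G S : Finset _) : Set (Set (Euc d)))) :=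
          Submodule.span_mono (image_mono (by simp)) hspan
        exact Submodule.add_mem _ h1 (Submodule.smul_mem _ _ (Submodule.sub_mem _ h2 h1))

lemma aux_chain {d : ℕ} (W : Finset (Euc d)) (c : Set (Euc d) → Euc d)
    (hc : ∀ G, IsFace (convexHull ℝ (W : Set (Euc d))) G → c G ∈ G) (n : ℕ) :
    ∀ G, IsFace (convexHull ℝ (W : Set (Euc d))) G → faceDim G = n → ∀ y ∈ G,
      (∃ S : Finset (Set (Euc d)), (∀ h ∈ S, IsFace (convexHull ℝ (W : Set (Euc d))) h) ∧
        S.card ≤ n ∧ y ∈ Submodule.span ℝ (c '' (S : Set (Set (Euc d))))) ∨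
      ∃ (g : ℕ → Set (Euc d)) (x : ℕ → ℝ),
        (∀ i ≤ n, IsFace (convexHull ℝ (W : Set (Euc d))) (g i) ∧ faceDim (g i) = i) ∧
        (∀ i j, i ≤ j → j ≤ n → g i ⊆ g j) ∧ g n = G ∧
        (∀ i < n, 0 ≤ x i ∧ x i ≤ 1) ∧ (∀ i j, i ≤ j → j < n → x i ≤ x j) ∧
        y = c G + ∑ i ∈ Finset.range n, x i • (c (g i) - c (g (i + 1))) := by
  induction n with
  | zero =>
    intro G hG hn y hy
    right
    have hyc : y = c G := by
      by_contra hyc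
      obtain ⟨G', hG', -, hlt, -⟩ := aux_subface W G hG (c G) y (hc G hG) hy hyc
      omega
    refine ⟨fun _ => G, fun _ => 0, ?_, ?_, rfl, ?_, ?_, ?_⟩
    · intro i hi
      exact ⟨hG, by show faceDim G = i; omega⟩
    · intro i j _ _; exact Subset.rfl
    · intro i hi; omega
    · intro i j _ hj; omega
    · simp [hyc]
  | succ n ih =>
    intro G hG hn y hy
    by_cases hyc : y = c G
    · left
      exact ⟨{G}, by simpa using hG, by simp, by
        rw [hyc]; exact Submodule.subset_span (by simp)⟩
    obtain ⟨G', hG', hsub, hlt, y', hy', s, hs0, hs1, hys⟩ :=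
        aux_subface W G hG (c G) y (hc G hG) hy hyc
    have bad : (∃ S : Finset (Set (Euc d)),
        (∀ h ∈ S, IsFace (convexHull ℝ (W : Set (Euc d))) h) ∧
        S.card ≤ n ∧ y' ∈ Submodule.span ℝ (c '' (S : Set (Set (Euc d))))) →
        (∃ S : Finset (Set (Euc d)), (∀ h ∈ S, IsFace (convexHull ℝ (W : Set (Euc d))) h) ∧
        S.card ≤ n + 1 ∧ y ∈ Submodule.span ℝ (c '' (S : Set (Set (Euc d))))) := by
      rintro ⟨S, hS, hcard, hspan⟩
      refine ⟨insert G S, ?_, ?_, ?_⟩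
      · intro h hh
        rcases Finset.mem_insert.1 hh with rfl | hh
        · exact hG
        · exact hS h hh
      · have := Finset.card_insert_le G S
        omega
      · have h1 : c G ∈ Submodule.span ℝ (c '' ((insert G S : Finset _) : Set (Set (Euc d)))) :=
          Submodule.subset_span ⟨G, by simp, rfl⟩
        have h2 : y' ∈ Submodule.span ℝ (c '' ((insert G S : Finset _) : Set (Set (Euc d)))) :=
          Submodule.span_mono (image_mono (by simp)) hspan
        rw [hys]
        exact Submodule.add_mem _ h1 (Submodule.smul_mem _ _ (Submodule.sub_mem _ h2 h1))
    by_cases hdim : faceDim G' = n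
    · rcases ih G' hG' hdim y' hy' with h | ⟨g, x, hg, hmono, hgn, hx, hxm, hyy⟩
      · exact Or.inl (bad h)
      · right
        refine ⟨fun i => if i ≤ n then g i else G, fun i => if i < n then s * x i else s,
          ?_, ?_, ?_, ?_, ?_, ?_⟩
        · intro i hi
          by_cases h : i ≤ n
          · simpa [h] using hg i h
          · have : i = n + 1 := by omega
            subst this
            simpa using ⟨hG, hn⟩
        · intro i j hij hj
          by_cases h : j ≤ n
          · simpa [h, hij.trans h] using hmono i j hij h
          · by_cases h' : i ≤ n
            · simp only [h, h', if_true, if_false]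
              exact (hmono i n h' le_rfl).trans (hgn ▸ hsub)
            · simp [h, h']
        · simp
        · intro i hi
          by_cases h : i < n
          · simp only [h, if_true]
            exact ⟨mul_nonneg hs0 (hx i h).1, mul_le_one₀ hs1 (hx i h).1 (hx i h).2⟩
          · simp [h, hs0, hs1]
        · intro i j hij hj
          by_cases h : j < n
          · simp only [h, hij.trans_lt h, if_true]
            exact mul_le_mul_of_nonneg_left (hxm i j hij h) hs0
          · by_cases h' : i < n
            · simp only [h, h', if_true, if_false]
              exact mul_le_of_le_one_right hs0 (hx i h').2
            · simp [h, h']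
        · rw [Finset.sum_range_succ]
          have e : ∑ i ∈ Finset.range n, (if i < n then s * x i else s) •
              (c (if i ≤ n then g i else G) - c (if i + 1 ≤ n then g (i + 1) else G)) =
              s • ∑ i ∈ Finset.range n, x i • (c (g i) - c (g (i + 1))) := by
            rw [Finset.smul_sum]
            refine Finset.sum_congr rfl ?_
            intro i hi
            have hi := Finset.mem_range.1 hi
            rw [if_pos hi, if_pos hi.le, if_pos (by omega), smul_smul]
          simp only [e]
          rw [if_neg (by omega), if_pos le_rfl, if_neg (by omega), hgn, hys, hyy]
          module
    · left
      obtain ⟨S, hS, hcard, hspan⟩ := aux_span W c hc (faceDim G') G' hG' rfl y' hy'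
      exact bad ⟨S, hS, by omega, hspan⟩

lemma aux_cross {d : ℕ} (g : ℕ → Set (Euc d)) (c : ℕ → Euc d) (κ : ℝ) (m : ℕ)
    (hconv : ∀ i ≤ m, Convex ℝ (g i)) (hmono : ∀ i j, i ≤ j → j ≤ m → g i ⊆ g j)
    (hc : ∀ i ≤ m, c i ∈ g i)
    (hk : ∀ i ≤ m, ∀ a ∈ g i, ∀ b ∈ g i, c i + κ • (a - b) ∈ g i) :
    ∀ (s : ℝ) (z : ℕ → ℝ), 0 ≤ s → (∀ i < m, 0 ≤ z i ∧ z i ≤ s) →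
      (∀ i j, i ≤ j → j < m → z i ≤ z j) →
      (s • c m + ∑ i ∈ Finset.range m, z i • (c i - c (i + 1)) ∈ s • g m) ∧
      ∀ j < m, ∀ σ : ℝ, (σ = κ ∨ σ = -κ) →
        s • c m + ∑ i ∈ Finset.range m, z i • (c i - c (i + 1)) +
          (σ * (s - z j)) • (c j - c (j + 1)) ∈ s • g m := by
  induction m with
  | zero =>
    intro s z hs _ _
    refine ⟨?_, fun j hj => absurd hj (by omega)⟩
    simpa using smul_mem_smul_set (hc 0 le_rfl)
  | succ m ih =>
    intro s z hs hz hzm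
    have ih' := ih (fun i hi => hconv i (by omega)) (fun i j hij hj => hmono i j hij (by omega))
      (fun i hi => hc i (by omega)) (fun i hi => hk i (by omega)) (z m) z (hz m (by omega)).1
      (fun i hi => ⟨(hz i (by omega)).1, hzm i m (by omega) (by omega)⟩)
      (fun i j hij hj => hzm i j hij (by omega))
    have hzm0 := (hz m (by omega)).1
    have hzms : 0 ≤ s - z m := sub_nonneg.2 (hz m (by omega)).2
    have hdec : s • g (m + 1) = (s - z m) • g (m + 1) + z m • g (m + 1) := by
      rw [← (hconv (m + 1) le_rfl).add_smul hzms hzm0, sub_add_cancel]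
    have hsubm : z m • g m ⊆ z m • g (m + 1) :=
      smul_set_mono (hmono m (m + 1) (by omega) le_rfl)
    rw [Finset.sum_range_succ, hdec]
    set sm := ∑ i ∈ Finset.range m, z i • (c i - c (i + 1))
    constructor
    · have e : s • c (m + 1) + (sm + z m • (c m - c (m + 1))) =
          (s - z m) • c (m + 1) + (z m • c m + sm) := by module
      rw [e]
      exact add_mem_add (smul_mem_smul_set (hc _ le_rfl)) (hsubm ih'.1)
    · intro j hj σ hσ
      have hkk : ∀ a ∈ g (m + 1), ∀ b ∈ g (m + 1), c (m + 1) + σ • (a - b) ∈ g (m + 1) := by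
        intro a ha b hb
        rcases hσ with rfl | rfl
        · exact hk _ le_rfl a ha b hb
        · have := hk _ le_rfl b hb a ha
          convert this using 2
          module
      by_cases hjm : j < m
      · have e : s • c (m + 1) + (sm + z m • (c m - c (m + 1))) + (σ * (s - z j)) • (c j - c (j + 1)) =
          (s - z m) • (c (m + 1) + σ • (c j - c (j + 1))) +
            (z m • c m + sm + (σ * (z m - z j)) • (c j - c (j + 1))) := by module
        rw [e]
        refine add_mem_add (smul_mem_smul_set (hkk _ ?_ _ ?_)) (hsubm (ih'.2 j hjm σ hσ))
        · exact hmono j _ (by omega) le_rfl (hc j (by omega))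
        · exact hmono (j + 1) _ (by omega) le_rfl (hc (j + 1) (by omega))
      · have : j = m := by omega
        subst this
        have e : s • c (j + 1) + (sm + z j • (c j - c (j + 1))) + (σ * (s - z j)) • (c j - c (j + 1)) =
          (s - z j) • (c (j + 1) + σ • (c j - c (j + 1))) + (z j • c j + sm) := by module
        rw [e]
        refine add_mem_add (smul_mem_smul_set (hkk _ ?_ _ ?_)) (hsubm ih'.1)
        · exact hmono j _ (by omega) le_rfl (hc j (by omega))
        · exact hc (j + 1) (by omega)

lemma aux_line_bdd {d : ℕ} (P : Set (Euc d)) (hb : Bornology.IsBounded P) (p v : Euc d)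
    (hv : v ≠ 0) : Bornology.IsBounded {t : ℝ | p + t • v ∈ P} := by
  obtain ⟨M, hM⟩ := hb.exists_norm_le
  refine (Metric.isBounded_closedBall (x := (0 : ℝ)) (r := (M + ‖p‖) / ‖v‖)).subset ?_
  intro T hT
  rw [mem_closedBall_zero_iff, le_div_iff₀ (norm_pos_iff.2 hv), ← norm_smul]
  have h1 := hM _ hT
  have h2 := norm_sub_le (p + T • v) p
  rw [add_sub_cancel_left] at h2
  linarith

lemma aux_hilbert {d : ℕ} (P : Set (Euc d)) (hP : Convex ℝ P) (hb : Bornology.IsBounded P)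
    (h0 : (0 : Euc d) ∈ interior P) (y : Euc d) (hy : y ∉ interior P) (t R : ℝ) (ht : 0 ≤ t)
    (hR : 0 ≤ R)
    (hU : t • y ∈ interior P) (hd : hilbertDist (interior P) 0 (t • y) ≤ R) :
    t ≤ 1 - Real.exp (-2 * R) := by
  have hy0 : y ≠ 0 := by rintro rfl; exact hy h0
  rcases ht.eq_or_lt with rfl | htp
  · have : Real.exp (-2 * R) ≤ 1 := Real.exp_le_one_iff.2 (by linarith)
    linarith
  have hp0 : t • y ≠ 0 := smul_ne_zero htp.ne' hy0
  set p := t • y with hp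
  have hUc : Convex ℝ (interior P) := hP.interior
  rw [hilbertDist, if_neg hp0.symm] at hd
  simp only [sub_zero, zero_add] at hd
  set A := {τ : ℝ | τ • p ∈ interior P} with hA
  have hAb : Bornology.IsBounded A := by
    have := aux_line_bdd P hb 0 p hp0
    refine this.subset ?_
    intro τ hτ
    have hτ' : τ • p ∈ interior P := hτ
    show 0 + τ • p ∈ P
    rw [zero_add]; exact interior_subset hτ'
  have hAo : IsOpen A := isOpen_interior.preimage (f := fun τ : ℝ => τ • p) (by fun_prop)
  have h0A : (0 : ℝ) ∈ A := by show (0 : ℝ) • p ∈ interior P; rw [zero_smul]; exact h0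
  have h1A : (1 : ℝ) ∈ A := by show (1 : ℝ) • p ∈ interior P; rw [one_smul]; exact hU
  have hm : sInf A < 0 := by
    obtain ⟨ε, hε, hball⟩ := Metric.isOpen_iff.1 hAo 0 h0A
    have : -(ε / 2) ∈ A := hball (by
      rw [mem_ball_zero_iff, Real.norm_eq_abs, abs_neg, abs_of_pos (by linarith)]; linarith)
    exact (csInf_le hAb.bddBelow this).trans_lt (by linarith)
  have hM : 1 < sSup A := by
    obtain ⟨ε, hε, hball⟩ := Metric.isOpen_iff.1 hAo 1 h1A
    have : 1 + ε / 2 ∈ A := hball (by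
      rw [mem_ball_iff_norm, Real.norm_eq_abs, add_sub_cancel_left, abs_of_pos (by linarith)]; linarith)
    exact lt_of_lt_of_le (by linarith) (le_csSup hAb.bddAbove this)
  have hMt : sSup A ≤ 1 / t := by
    refine csSup_le ⟨0, h0A⟩ ?_
    intro τ hτ
    by_contra hlt
    push Not at hlt
    have h1 : 1 < τ * t := by rwa [div_lt_iff₀ htp] at hlt
    have hτ' : τ • p ∈ interior P := hτ
    apply hy
    have := hUc.smul_mem_of_zero_mem h0 hτ' (t := 1 / (τ * t)) ⟨by positivity, by
      rw [div_le_one (by linarith)]; exact h1.le⟩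
    rwa [hp, smul_smul, smul_smul, mul_assoc, one_div_mul_cancel (by linarith), one_smul] at this
  set m := sInf A
  set M := sSup A
  have f1 : 1 ≤ (1 - m) / (-m) := by rw [le_div_iff₀ (by linarith)]; linarith
  have hMtt : M * t ≤ 1 := by rwa [le_div_iff₀ htp] at hMt
  have ht1 : t < 1 := by nlinarith
  have f2 : 1 / (1 - t) ≤ M / (M - 1) := by
    rw [div_le_div_iff₀ (by linarith) (by linarith)]; nlinarith
  have f3 : 1 / (1 - t) ≤ (1 - m) / (-m) * (M / (M - 1)) := by
    have : 0 < M / (M - 1) := div_pos (by linarith) (by linarith)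
    nlinarith
  have f4 : Real.log (1 / (1 - t)) ≤ 2 * R :=
    (Real.log_le_log (by apply one_div_pos.2; linarith) f3).trans (by linarith)
  rw [one_div, Real.log_inv] at f4
  have : Real.exp (-2 * R) ≤ 1 - t := by
    rw [← Real.le_log_iff_exp_le (by linarith)]; linarith
  linarith

lemma aux_polar {d : ℕ} (P : Set (Euc d)) (hP : Convex ℝ P) (hb : Bornology.IsBounded P)
    (p w : Euc d) (hp : p ∈ interior P) (h1 : p + w ∈ P) (h2 : p - w ∈ P) (y : Euc d)
    (hy : y ∈ polarSet (finslerUnitBall (interior P) p)) : |⟪w, y⟫| ≤ (1 : ℝ) := by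
  by_cases hw : w = 0
  · simp [hw]
  have main : ∀ u : Euc d, u ≠ 0 → p + u ∈ P → p - u ∈ P → ⟪u, y⟫ ≤ (1 : ℝ) := by
    intro u hu h1 h2
    have sup : ∀ (r : ℝ) (v : Euc d), 0 < r → r < 1 → v ≠ 0 → p + v ∈ P →
        1 / sSup {t : ℝ | 0 < t ∧ p + t • (r • v) ∈ interior P} ≤ r := by
      intro r v hr hr1 hv hpv
      have hbd : BddAbove {t : ℝ | 0 < t ∧ p + t • (r • v) ∈ interior P} := by
        refine (aux_line_bdd P hb p (r • v) (smul_ne_zero hr.ne' hv)).bddAbove.mono ?_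
        intro t ht
        exact (interior_subset ht.2 : p + t • (r • v) ∈ P)
      have hle : 1 / r ≤ sSup {t : ℝ | 0 < t ∧ p + t • (r • v) ∈ interior P} := by
        refine le_of_forall_lt_imp_le_of_dense ?_
        intro a ha
        by_cases ha0 : a ≤ 0
        · refine ha0.trans (Real.sSup_nonneg ?_)
          intro t ht; exact ht.1.le
        · push Not at ha0
          refine le_csSup hbd ⟨ha0, ?_⟩
          have har : a * r < 1 := by rwa [lt_div_iff₀ hr] at ha
          have := hP.add_smul_sub_mem_interior hpv hp (t := 1 - a * r) ⟨by linarith, by nlinarith⟩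
          convert this using 1
          module
      rw [one_div] at hle ⊢
      exact inv_le_of_inv_le₀ hr hle
    have hr : ∀ r : ℝ, 0 < r → r < 1 → r * ⟪u, y⟫ ≤ 1 := by
      intro r hr0 hr1
      have hmem : r • u ∈ finslerUnitBall (interior P) p := by
        show finslerNorm (interior P) p (r • u) < 1
        rw [finslerNorm, if_neg (smul_ne_zero hr0.ne' hu)]
        have k1 := sup r u hr0 hr1 hu h1
        have k2 := sup r (-u) hr0 hr1 (neg_ne_zero.2 hu) (by rwa [← sub_eq_add_neg])
        simp only [smul_neg, ← sub_eq_add_neg] at k2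
        linarith
      have := hy _ hmem
      rwa [real_inner_smul_left] at this
    by_contra hlt
    push Not at hlt
    have h3 := hr ((1 + 1 / ⟪u, y⟫) / 2) (by positivity) (by
      have : 1 / ⟪u, y⟫ < (1 : ℝ) := by rw [div_lt_one (by linarith)]; exact hlt
      linarith)
    have h4 : (1 + 1 / ⟪u, y⟫) / 2 * ⟪u, y⟫ = ((⟪u, y⟫ : ℝ) + 1) / 2 := by
      have : (⟪u, y⟫ : ℝ) ≠ 0 := by linarith
      field_simp
    linarith
  rw [abs_le]
  refine ⟨?_, main w hw h1 h2⟩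
  have := main (-w) (neg_ne_zero.2 hw) (by rwa [← sub_eq_add_neg]) (by rwa [sub_neg_eq_add])
  rw [inner_neg_left] at this
  linarith

lemma aux_prod_integral {d : ℕ} (h : ℝ → ℝ) (a : ℝ) (hc : ContinuousOn h (Icc 0 a))
    (hpos : ∀ t ∈ Icc (0 : ℝ) a, 0 ≤ h t) :
    ∫⁻ x : Fin d → ℝ in Set.pi univ (fun _ => Icc 0 a), ∏ i, ENNReal.ofReal (h (x i)) =
      ENNReal.ofReal ((∫ t in Icc 0 a, h t) ^ d) := by
  have hbox : MeasurableSet (Set.pi univ (fun _ : Fin d => Icc (0 : ℝ) a)) :=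
    MeasurableSet.univ_pi fun _ => measurableSet_Icc
  have hint : IntegrableOn h (Icc 0 a) := hc.integrableOn_compact isCompact_Icc
  have hres : (volume : Measure (Fin d → ℝ)).restrict (Set.pi univ (fun _ => Icc 0 a)) =
      Measure.pi (fun _ : Fin d => (volume : Measure ℝ).restrict (Icc 0 a)) := by
    rw [volume_pi, Measure.restrict_pi_pi]
  have e1 : ∫⁻ x : Fin d → ℝ in Set.pi univ (fun _ => Icc 0 a), ∏ i, ENNReal.ofReal (h (x i)) =
      ∫⁻ x : Fin d → ℝ in Set.pi univ (fun _ => Icc 0 a), ENNReal.ofReal (∏ i, h (x i)) := by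
    refine setLIntegral_congr_fun hbox ?_
    intro x hx
    exact (ENNReal.ofReal_prod_of_nonneg fun i _ => hpos _ (hx i (mem_univ i))).symm
  rw [e1, ← ofReal_integral_eq_lintegral_ofReal]
  · rw [hres, integral_fintype_prod_eq_prod (𝕜 := ℝ) (fun _ : Fin d => h)]
    simp
  · rw [hres]
    exact Integrable.fintype_prod (𝕜 := ℝ) (f := fun _ : Fin d => h) fun _ => hint
  · filter_upwards [ae_restrict_mem hbox] with x hx
    exact Finset.prod_nonneg fun i _ => hpos _ (hx i (mem_univ i))

lemma aux_log_integral (C a : ℝ) (ha0 : 0 ≤ a) (ha1 : a < 1) :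
    ∫ t in Icc 0 a, C / (1 - t) = C * (-Real.log (1 - a)) := by
  rw [integral_Icc_eq_integral_Ioc, ← intervalIntegral.integral_of_le ha0]
  have := intervalIntegral.integral_eq_sub_of_hasDerivAt (a := 0) (b := a)
    (f := fun t => -(C * Real.log (1 - t))) (f' := fun t => C / (1 - t)) ?_ ?_
  · rw [this]; simp
  · intro t ht
    rw [uIcc_of_le ha0] at ht
    have h1 : (1 - t) ≠ 0 := by linarith [ht.2]
    have := (((hasDerivAt_id t).const_sub 1).log h1).const_mul C |>.neg
    refine HasDerivAt.congr_deriv (f := fun t => -(C * Real.log (1 - t))) this ?_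
    simp only [id]; field_simp
  · apply ContinuousOn.intervalIntegrable
    rw [uIcc_of_le ha0]
    refine ContinuousOn.div (by fun_prop) (by fun_prop) ?_
    intro t ht; linarith [ht.2]

lemma aux_det_adjoint {d : ℕ} (A : Euc d →ₗ[ℝ] Euc d) :
    LinearMap.det (LinearMap.adjoint A) = LinearMap.det A := by
  let v := EuclideanSpace.basisFun (Fin d) ℝ
  rw [← LinearMap.det_toMatrix v.toBasis, ← LinearMap.det_toMatrix v.toBasis A,
    LinearMap.toMatrix_adjoint v v, Matrix.det_conjTranspose]
  simp

lemma aux_box_volume {d : ℕ} (r : Fin d → ℝ) :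
    volume {v : Euc d | ∀ i, |v i| ≤ r i} = ∏ i, ENNReal.ofReal (2 * r i) := by
  have h := (PiLp.volume_preserving_ofLp (Fin d)).measure_preimage
    (s := Set.pi univ (fun i => Icc (-(r i)) (r i)))
    (MeasurableSet.univ_pi fun _ => measurableSet_Icc).nullMeasurableSet
  have e : {v : Euc d | ∀ i, |v i| ≤ r i} =
      (@WithLp.ofLp 2 (Fin d → ℝ)) ⁻¹' (Set.pi univ (fun i => Icc (-(r i)) (r i))) := by
    ext v; simp [abs_le, Pi.le_def, forall_and]
  rw [e, h, volume_pi_pi]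
  refine Finset.prod_congr rfl fun i _ => ?_
  rw [Real.volume_Icc]; congr 1; ring

lemma aux_simplex_vol {d : ℕ} (b : Fin d → Euc d) (P : Set (Euc d)) (hP : Convex ℝ P)
    (hb : Bornology.IsBounded P) (κ a : ℝ) (hκ : 0 < κ) (ha0 : 0 ≤ a) (ha1 : a < 1)
    (D : Set (Euc d)) (hD : D ⊆ interior P)
    (hx : ∀ p ∈ D, ∃ x : Fin d → ℝ, p = ∑ i, x i • b i ∧ (∀ i, x i ∈ Icc 0 a) ∧
      ∀ i, p + (κ * (1 - x i)) • b i ∈ P ∧ p - (κ * (1 - x i)) • b i ∈ P) :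
    htVol (interior P) D ≤ ENNReal.ofReal ((2 / κ * (-Real.log (1 - a))) ^ d) /
      volume (Metric.ball (0 : Euc d) 1) := by
  let A : Euc d →ₗ[ℝ] Euc d :=
    (Fintype.linearCombination ℝ b) ∘ₗ (WithLp.linearEquiv 2 ℝ (Fin d → ℝ)).toLinearMap
  have hA : ∀ x : Euc d, A x = ∑ i, x i • b i := by
    intro x; simp [A, Fintype.linearCombination_apply]
  have hDA : D ⊆ LinearMap.range A := by
    intro p hp
    obtain ⟨x, rfl, -⟩ := hx p hp
    exact ⟨WithLp.toLp 2 x, by rw [hA]⟩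
  by_cases hdet : LinearMap.det A = 0
  · have : volume D = 0 := measure_mono_null hDA
      (Measure.addHaar_submodule _ _ (LinearMap.range_lt_top_of_det_eq_zero hdet).ne)
    rw [htVol, setLIntegral_measure_zero _ _ this]
    exact zero_le
  let e : Euc d ≃ₗ[ℝ] Euc d := LinearMap.equivOfDetNeZero A hdet
  have he : ∀ x, e x = A x := fun x => rfl
  have heA : ∀ x, e.symm (A x) = x := fun x => by rw [← he, e.symm_apply_apply]
  let h : ℝ → ℝ := fun t => (2 / κ) / (1 - t)
  have hhm : Measurable h := by fun_prop
  let ω := volume (Metric.ball (0 : Euc d) 1)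
  let g : Euc d → ℝ≥0∞ := fun p =>
    ENNReal.ofReal |(LinearMap.det A)⁻¹| * (∏ i, ENNReal.ofReal (h (e.symm p i))) / ω
  have hsymm : Continuous e.symm := e.symm.toLinearMap.continuous_of_finiteDimensional
  have hg : Measurable g := by
    have : ∀ i, Measurable fun p : Euc d => e.symm p i := fun i => by
      have : Continuous fun p : Euc d => e.symm p i := by fun_prop
      exact this.measurable
    simp only [g]
    refine Measurable.div_const (Measurable.const_mul ?_ _) _
    refine Finset.measurable_prod _ fun i _ => ?_
    exact (hhm.comp (this i)).ennreal_ofReal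
  let box : Set (Euc d) := (@WithLp.ofLp 2 (Fin d → ℝ)) ⁻¹' (Set.pi univ (fun _ => Icc 0 a))
  have hbox : MeasurableSet box :=
    (PiLp.volume_preserving_ofLp (Fin d)).measurable
      (MeasurableSet.univ_pi fun _ => measurableSet_Icc)
  have hDbox : D ⊆ A '' box := by
    intro p hp
    obtain ⟨x, rfl, hxa, -⟩ := hx p hp
    exact ⟨WithLp.toLp 2 x, fun i _ => hxa i, by rw [hA]⟩
  -- pointwise bound
  have hpt : ∀ p ∈ D, volume (polarSet (finslerUnitBall (interior P) p)) / ω ≤ g p := by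
    intro p hp
    obtain ⟨x, hpx, hxa, hcr⟩ := hx p hp
    have hpA : p = A (WithLp.toLp 2 x) := by rw [hA, hpx]
    refine ENNReal.div_le_div_right ?_ _
    have hsub : polarSet (finslerUnitBall (interior P) p) ⊆
        (LinearMap.adjoint A) ⁻¹' {v : Euc d | ∀ i, |v i| ≤ 1 / (κ * (1 - x i))} := by
      intro y hy i
      have hpos : 0 < κ * (1 - x i) := mul_pos hκ (by linarith [(hxa i).2])
      have k := aux_polar P hP hb p _ (hD hp) (hcr i).1 (hcr i).2 y hy
      have e1 : (LinearMap.adjoint A y) i = ⟪b i, y⟫ := by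
        have : ⟪EuclideanSpace.single i (1 : ℝ), LinearMap.adjoint A y⟫ = ⟪b i, y⟫ := by
          rw [LinearMap.adjoint_inner_right, hA]
          congr 1
          simp
        rw [← this]; simp [EuclideanSpace.inner_single_left]
      rw [e1, le_div_iff₀ hpos]
      rw [real_inner_smul_left, abs_mul, abs_of_pos hpos] at k
      linarith
    refine (measure_mono hsub).trans ?_
    rw [Measure.addHaar_preimage_linearMap _ (by rwa [aux_det_adjoint]), aux_det_adjoint,
      aux_box_volume]
    refine le_of_eq ?_
    congr 1
    refine Finset.prod_congr rfl fun i _ => ?_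
    rw [hpA, heA]
    have hpos : 0 < (1 - x i) := by linarith [(hxa i).2]
    congr 1
    simp only [h]
    field_simp
  have hinj : InjOn A box := e.injective.injOn
  calc htVol (interior P) D ≤ ∫⁻ p in D, g p := setLIntegral_mono hg hpt
    _ ≤ ∫⁻ p in A '' box, g p := lintegral_mono_set hDbox
    _ = ∫⁻ x in box, ENNReal.ofReal |(LinearMap.toContinuousLinearMap A).det| * g (A x) :=
        lintegral_image_eq_lintegral_abs_det_fderiv_mul volume hbox
          (fun x _ => (LinearMap.toContinuousLinearMap A).hasFDerivAt.hasFDerivWithinAt) hinj g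
    _ = ∫⁻ x in box, (∏ i, ENNReal.ofReal (h (x i))) * ω⁻¹ := by
        refine lintegral_congr fun x => ?_
        simp only [g, heA]
        rw [ENNReal.div_eq_inv_mul, mul_comm ω⁻¹, ← mul_assoc, ← mul_assoc,
          ← ENNReal.ofReal_mul (abs_nonneg _)]
        have : |(LinearMap.toContinuousLinearMap A).det| * |(LinearMap.det A)⁻¹| = 1 := by
          rw [← abs_mul]
          have : (LinearMap.toContinuousLinearMap A).det = LinearMap.det A := rfl
          rw [this, mul_inv_cancel₀ hdet, abs_one]
        rw [this, ENNReal.ofReal_one, one_mul]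
    _ = (∫⁻ x in box, (∏ i, ENNReal.ofReal (h (x i)))) * ω⁻¹ := by
        refine lintegral_mul_const _ ?_
        refine Finset.measurable_prod _ fun i _ => ?_
        exact (hhm.comp (by
          have : Continuous fun p : Euc d => p i := by fun_prop
          exact this.measurable)).ennreal_ofReal
    _ = (∫⁻ x : Fin d → ℝ in Set.pi univ (fun _ => Icc 0 a),
          (∏ i, ENNReal.ofReal (h (x i)))) * ω⁻¹ := by
        congr 1
        exact (PiLp.volume_preserving_ofLp (Fin d)).setLIntegral_comp_preimage
          (MeasurableSet.univ_pi fun _ => measurableSet_Icc)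
          (f := fun x : Fin d → ℝ => ∏ i, ENNReal.ofReal (h (x i)))
          (Finset.measurable_prod _ fun i _ => (hhm.comp (measurable_pi_apply i)).ennreal_ofReal)
    _ = _ := by
        rw [aux_prod_integral h a, aux_log_integral _ _ ha0 ha1, ENNReal.div_eq_inv_mul, mul_comm]
        · refine ContinuousOn.div (by fun_prop) (by fun_prop) ?_
          intro t ht; linarith [ht.2]
        · intro t ht
          have : 0 < 1 - t := by linarith [ht.2]
          simp only [h]
          positivity

lemma aux_main (n : ℕ) (l : ℝ) (hl0 : 0 < l) (hl1 : l ≤ 1)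
    (W : Finset (Euc (n + 1))) (P : Set (Euc (n + 1)))
    (hPW : P = convexHull ℝ (W : Set (Euc (n + 1)))) (hPd : faceDim P = n + 1)
    (hlP : l • Metric.closedBall (0 : Euc (n + 1)) 1 ⊆ P)
    (hPB : P ⊆ Metric.closedBall (0 : Euc (n + 1)) 1)
    (F : Set (Euc (n + 1))) (hF : IsFace P F) (hFd : faceDim F = n) (R : ℝ) (hR : 0 ≤ R) :
    htVol (interior P)
      (hilbertBall (interior P) 0 R ∩
        {x : Euc (n + 1) | ∃ y ∈ F, ∃ t : ℝ, 0 ≤ t ∧ t ≤ 1 ∧ x = t • y}) ≤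
    ((flagSet n F).ncard : ℝ≥0∞) *
      (ENNReal.ofReal ((2 / (l / (2 * ((n + 1 : ℕ) : ℝ))) * (2 * R)) ^ (n + 1)) /
        volume (Metric.ball (0 : Euc (n + 1)) 1)) := by
  have hN : (1 : ℝ) ≤ ((n + 1 : ℕ) : ℝ) := by push_cast; linarith [Nat.cast_nonneg (α := ℝ) n]
  set N : ℝ := ((n + 1 : ℕ) : ℝ) with hNdef
  set κ : ℝ := l / (2 * N) with hκdef
  have hκ : 0 < κ := by positivity
  have hPconv : Convex ℝ P := hPW ▸ convex_convexHull ℝ _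
  have hPbd : Bornology.IsBounded P := Metric.isBounded_closedBall.subset hPB
  have h0 : (0 : Euc (n + 1)) ∈ interior P := by
    refine mem_interior_iff_mem_nhds.2 (Filter.mem_of_superset (Metric.ball_mem_nhds 0 hl0) ?_)
    intro x hx
    refine hlP ⟨l⁻¹ • x, ?_, by simp [smul_smul, hl0.ne']⟩
    rw [mem_ball_zero_iff] at hx
    rw [mem_closedBall_zero_iff, norm_smul, norm_inv, Real.norm_of_nonneg hl0.le,
      inv_mul_le_iff₀ hl0]
    linarith
  -- faces of `P`
  have hcomp : ∀ G, IsFace P G → IsCompact G := by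
    intro G hG
    exact aux_extreme_closed W G hG.2.2.1 (hPW ▸ hG.2.2.2)
  have hcen : ∀ G, ∃ c : Euc (n + 1), IsFace P G → c ∈ G ∧ ∀ x ∈ G, c + (1 / N) • (c - x) ∈ G := by
    intro G
    by_cases hG : IsFace P G
    · obtain ⟨c, hc, hcc⟩ := aux_exists_center (by omega) G hG.2.2.1 (hcomp G hG) hG.1
      exact ⟨c, fun _ => ⟨hc, hcc⟩⟩
    · exact ⟨0, fun h => absurd h hG⟩
  choose c hc using hcen
  have hck : ∀ G, IsFace P G → ∀ a ∈ G, ∀ b ∈ G, c G + κ • (a - b) ∈ G := by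
    intro G hG a ha b hb
    have hGc := hG.2.2.1
    obtain ⟨h1, h2⟩ := hc G hG
    have h3 : c G + (1 / N) • (a - c G) ∈ G :=
      hGc.add_smul_sub_mem h1 ha ⟨by positivity, by rw [div_le_one (by positivity)]; exact hN⟩
    have h4 := hGc (h2 b hb) h3 (a := 1 / 2) (b := 1 / 2) (by norm_num) (by norm_num) (by norm_num)
    have h5 : c G + (1 / (2 * N)) • (a - b) ∈ G := by
      convert h4 using 1
      match_scalars <;> field_simp <;> ring
    have := hGc.add_smul_mem h1 h5 (t := l) ⟨hl0.le, hl1⟩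
    rwa [smul_smul, mul_one_div] at this
  have hPk : ∀ a ∈ P, ∀ b ∈ P, (0 : Euc (n + 1)) + κ • (a - b) ∈ P := by
    intro a ha b hb
    refine hlP ⟨(1 / (2 * N)) • (a - b), ?_, ?_⟩
    · have h1 := hPB ha
      have h2 := hPB hb
      rw [mem_closedBall_zero_iff] at h1 h2 ⊢
      rw [norm_smul, Real.norm_of_nonneg (by positivity), one_div, inv_mul_le_iff₀ (by positivity)]
      linarith [norm_sub_le a b]
    · show l • ((1 / (2 * N)) • (a - b)) = 0 + κ • (a - b)
      rw [zero_add, smul_smul, mul_one_div]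
  have hFP : F ⊆ P := hF.2.2.2.subset
  have hFint : ∀ y ∈ F, y ∉ interior P := by
    intro y hy hyi
    have : F = P := by
      refine Subset.antisymm hFP ?_
      intro z hz
      have hcont : Continuous fun τ : ℝ => y + τ • (y - z) := by fun_prop
      have hev : ∀ᶠ τ in 𝓝 (0 : ℝ), y + τ • (y - z) ∈ interior P :=
        hcont.continuousAt.eventually_mem (isOpen_interior.mem_nhds (by simpa using hyi))
      obtain ⟨ε, hε, hball⟩ := Metric.eventually_nhds_iff.1 hev
      have hm := hball (y := ε / 2) (by
        rw [Real.dist_eq, sub_zero, abs_of_pos (by linarith)]; linarith)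
      refine hF.2.2.2.left_mem_of_mem_openSegment hz (interior_subset hm) hy ?_
      refine ⟨(ε / 2) / (1 + ε / 2), 1 / (1 + ε / 2), by positivity, by positivity, ?_, ?_⟩
      · field_simp
        ring
      · match_scalars <;> field_simp <;> ring
    rw [this] at hFd
    omega
  -- finiteness
  have hfin : {G : Set (Euc (n + 1)) | IsFace P G}.Finite := hPW ▸ aux_faces_finite W
  have hflagface : ∀ f ∈ flagSet n F, ∀ i, IsFace P (f i) := by
    intro f hf i
    obtain ⟨h1, h2, h3, h4⟩ := (hf.1 i).1
    exact ⟨h1, h2, h3, hF.2.2.2.trans h4⟩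
  have hflagfin : (flagSet n F).Finite := by
    refine (Set.Finite.pi' (fun _ : Fin (n + 1) => hfin)).subset ?_
    intro f hf i
    exact hflagface f hf i
  -- the pieces
  set a : ℝ := 1 - Real.exp (-2 * R) with hadef
  have ha0 : 0 ≤ a := by
    have : Real.exp (-2 * R) ≤ 1 := Real.exp_le_one_iff.2 (by linarith)
    linarith
  have ha1 : a < 1 := by linarith [Real.exp_pos (-2 * R)]
  let gg : (Fin (n + 1) → Set (Euc (n + 1))) → ℕ → Set (Euc (n + 1)) :=
    fun f i => if h : i < n + 1 then f ⟨i, h⟩ else P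
  let cc : (Fin (n + 1) → Set (Euc (n + 1))) → ℕ → Euc (n + 1) :=
    fun f i => if h : i < n + 1 then c (f ⟨i, h⟩) else 0
  let D : (Fin (n + 1) → Set (Euc (n + 1))) → Set (Euc (n + 1)) := fun f =>
    {p | p ∈ interior P ∧ ∃ x : ℕ → ℝ, (∀ i < n + 1, 0 ≤ x i ∧ x i ≤ a) ∧
      (∀ i j, i ≤ j → j < n + 1 → x i ≤ x j) ∧
      p = ∑ i ∈ Finset.range (n + 1), x i • (cc f i - cc f (i + 1))}
  let Bad : Set (Euc (n + 1)) := ⋃ S ∈ {S : Finset (Set (Euc (n + 1))) | S ⊆ hfin.toFinset ∧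
    S.card ≤ n}, (Submodule.span ℝ (c '' (S : Set (Set (Euc (n + 1))))) : Set (Euc (n + 1)))
  have hBad : volume Bad = 0 := by
    have hcount : {S : Finset (Set (Euc (n + 1))) | S ⊆ hfin.toFinset ∧ S.card ≤ n}.Countable :=
      ((hfin.toFinset.powerset.finite_toSet).subset fun S hS => by
        simpa using hS.1).countable
    rw [measure_biUnion_null_iff hcount]
    intro S hS
    refine Measure.addHaar_submodule _ _ ?_
    intro htop
    have h1 := finrank_span_finset_le_card (R := ℝ) (S.image c)
    rw [Set.finrank, Finset.coe_image, htop, finrank_top, finrank_euclideanSpace_fin] at h1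
    have h2 := Finset.card_image_le (s := S) (f := c)
    have h3 := hS.2
    omega
  have hcover : (hilbertBall (interior P) 0 R ∩
        {x : Euc (n + 1) | ∃ y ∈ F, ∃ t : ℝ, 0 ≤ t ∧ t ≤ 1 ∧ x = t • y}) ⊆
      Bad ∪ ⋃ f : flagSet n F, D f := by
    rintro p ⟨⟨hpU, hpd⟩, y, hy, t, ht0, ht1, rfl⟩
    have hta : t ≤ a := aux_hilbert P hPconv hPbd h0 y (hFint y hy) t R ht0 hR hpU hpd
    rcases aux_chain W c (fun G hG => (hc G (hPW ▸ hG)).1) n F (hPW ▸ hF) hFd y hy with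
      ⟨S, hS, hcard, hspan⟩ | ⟨g, x, hg, hmono, hgn, hx, hxm, hyy⟩
    · left
      refine mem_iUnion₂.2 ⟨S, ⟨?_, hcard⟩, Submodule.smul_mem _ _ hspan⟩
      intro G hG
      rw [Set.Finite.mem_toFinset]
      have := hS G hG
      rw [← hPW] at this
      exact this
    · right
      have hf : (fun i : Fin (n + 1) => g i) ∈ flagSet n F := by
        refine ⟨fun i => ?_, fun i j hij => hmono i j hij (by omega)⟩
        obtain ⟨⟨h1, h2, h3, h4⟩, h5⟩ := hg i (by omega)
        rw [← hPW] at h4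
        exact ⟨⟨h1, h2, h3, h4.mono hFP (hgn ▸ hmono i n (by omega) le_rfl)⟩, h5⟩
      refine mem_iUnion.2 ⟨⟨_, hf⟩, hpU, fun i => if i < n then t * x i else t, ?_, ?_, ?_⟩
      · intro i hi
        by_cases h : i < n
        · simp only [h, if_true]
          exact ⟨mul_nonneg ht0 (hx i h).1, (mul_le_of_le_one_right ht0 (hx i h).2).trans hta⟩
        · simp only [h, if_false]; exact ⟨ht0, hta⟩
      · intro i j hij hj
        by_cases h : j < n
        · simp only [h, hij.trans_lt h, if_true]
          exact mul_le_mul_of_nonneg_left (hxm i j hij h) ht0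
        · by_cases h' : i < n
          · simp only [h, h', if_true, if_false]
            exact mul_le_of_le_one_right ht0 (hx i h').2
          · simp [h, h']
      · rw [Finset.sum_range_succ]
        have e : ∑ i ∈ Finset.range n, (if i < n then t * x i else t) •
            (cc (fun i : Fin (n + 1) => g i) i - cc (fun i : Fin (n + 1) => g i) (i + 1)) =
            t • ∑ i ∈ Finset.range n, x i • (c (g i) - c (g (i + 1))) := by
          rw [Finset.smul_sum]
          refine Finset.sum_congr rfl ?_
          intro i hi
          have hi := Finset.mem_range.1 hi
          simp only [cc]
          rw [if_pos hi, dif_pos (by omega), dif_pos (by omega), smul_smul]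
        simp only [e]
        simp only [cc]
        rw [if_neg (by omega), dif_pos (by omega), dif_neg (by omega), hgn, hyy]
        module
  -- volume of each piece
  have hpiece : ∀ f : flagSet n F, htVol (interior P) (D f) ≤
      ENNReal.ofReal ((2 / κ * (2 * R)) ^ (n + 1)) / volume (Metric.ball (0 : Euc (n + 1)) 1) := by
    rintro ⟨f, hf⟩
    have hlog : 2 * R = -Real.log (1 - a) := by
      rw [hadef, sub_sub_cancel, Real.log_exp]; ring
    rw [hlog]
    refine aux_simplex_vol (fun i : Fin (n + 1) => cc f i - cc f (i + 1)) P hPconv hPbd κ a hκ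
      ha0 ha1 _ (fun p hp => hp.1) ?_
    rintro p ⟨hpU, x, hxa, hxm, hpx⟩
    have hcr := aux_cross (gg f) (cc f) κ (n + 1) ?_ ?_ ?_ ?_ 1 x zero_le_one
      (fun i hi => ⟨(hxa i hi).1, (hxa i hi).2.trans ha1.le⟩) hxm
    · have hcn : cc f (n + 1) = 0 := by simp [cc]
      have hgn : gg f (n + 1) = P := by simp [gg]
      rw [hcn, hgn, smul_zero, zero_add, one_smul, ← hpx] at hcr
      refine ⟨fun i => x i, ?_, fun i => hxa i i.2, fun i => ⟨?_, ?_⟩⟩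
      · rw [hpx, Finset.sum_range]
      · exact hcr.2 i i.2 κ (Or.inl rfl)
      · have := hcr.2 i i.2 (-κ) (Or.inr rfl)
        rwa [neg_mul, neg_smul, ← sub_eq_add_neg] at this
    · intro i hi
      simp only [gg]
      split_ifs with h
      · exact (hflagface f hf _).2.2.1
      · exact hPconv
    · intro i j hij hj
      simp only [gg]
      split_ifs with h h' h'
      · exact hf.2 _ _ hij
      · exact (hflagface f hf _).2.2.2.subset
      · omega
      · exact Subset.rfl
    · intro i hi
      simp only [gg, cc]
      split_ifs with h
      · exact (hc _ (hflagface f hf _)).1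
      · exact interior_subset h0
    · intro i hi
      simp only [gg, cc]
      split_ifs with h
      · exact hck _ (hflagface f hf _)
      · exact hPk
  haveI : Fintype (flagSet n F) := hflagfin.fintype
  calc htVol (interior P) _ ≤ htVol (interior P) (Bad ∪ ⋃ f : flagSet n F, D f) :=
        lintegral_mono_set hcover
    _ ≤ htVol (interior P) Bad + htVol (interior P) (⋃ f : flagSet n F, D f) :=
        lintegral_union_le _ _ _
    _ = htVol (interior P) (⋃ f : flagSet n F, D f) := by
        rw [htVol, setLIntegral_measure_zero _ _ hBad, zero_add]
    _ ≤ ∑' f : flagSet n F, htVol (interior P) (D f) := lintegral_iUnion_le _ _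
    _ = ∑ f : flagSet n F, htVol (interior P) (D f) := tsum_fintype _
    _ ≤ ∑ _f : flagSet n F, ENNReal.ofReal ((2 / κ * (2 * R)) ^ (n + 1)) /
          volume (Metric.ball (0 : Euc (n + 1)) 1) := Finset.sum_le_sum fun f _ => hpiece f
    _ = _ := by
        rw [Finset.sum_const, nsmul_eq_mul, Finset.card_univ, ← Nat.card_eq_fintype_card,
          Nat.card_coe_set_eq]

/-- uniform polynomial bound on the Holmes–Thompson volume of the
intersection of a Hilbert ball of a polytope with the cone over a facet, in terms of the
number of maximal flags of the facet. -/
theorem htVol_cone_le (d : ℕ) (hd : 1 ≤ d) (l : ℝ) (hl0 : 0 < l) (hl1 : l ≤ 1) :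
    ∃ p : Polynomial ℝ, p.natDegree = d ∧
      ∀ (W : Finset (Euc d)) (P : Set (Euc d)), P = convexHull ℝ (W : Set (Euc d)) →
        W.Nonempty → faceDim P = d →
        l • Metric.closedBall (0 : Euc d) 1 ⊆ P → P ⊆ Metric.closedBall (0 : Euc d) 1 →
        ∀ F : Set (Euc d), IsFace P F → faceDim F = d - 1 →
        ∀ R : ℝ, 0 ≤ R →
          htVol (interior P)
            (hilbertBall (interior P) 0 R ∩
              {x : Euc d | ∃ y ∈ F, ∃ t : ℝ, 0 ≤ t ∧ t ≤ 1 ∧ x = t • y})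
          ≤ ENNReal.ofReal (p.eval R * ((flagSet (d - 1) F).ncard : ℝ)) := by
  obtain ⟨n, rfl⟩ : ∃ n, d = n + 1 := ⟨d - 1, by omega⟩
  have hω0 : volume (Metric.ball (0 : Euc (n + 1)) 1) ≠ 0 :=
    (Metric.measure_ball_pos volume _ one_pos).ne'
  have hωt : volume (Metric.ball (0 : Euc (n + 1)) 1) ≠ ⊤ := measure_ball_lt_top.ne
  have hω : 0 < (volume (Metric.ball (0 : Euc (n + 1)) 1)).toReal :=
    ENNReal.toReal_pos hω0 hωt
  set ω := (volume (Metric.ball (0 : Euc (n + 1)) 1)).toReal with hωdef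
  set q : ℝ := 2 / (l / (2 * ((n + 1 : ℕ) : ℝ))) * 2 with hq
  have hq0 : 0 < q := by positivity
  refine ⟨Polynomial.C (q ^ (n + 1) / ω) * Polynomial.X ^ (n + 1), ?_, ?_⟩
  · exact Polynomial.natDegree_C_mul_X_pow _ _ (by positivity)
  · intro W P hPW _ hPd hlP hPB F hF hFd R hR
    refine (aux_main n l hl0 hl1 W P hPW hPd hlP hPB F hF hFd R hR).trans (le_of_eq ?_)
    have e : volume (Metric.ball (0 : Euc (n + 1)) 1) = ENNReal.ofReal ω :=
      (ENNReal.ofReal_toReal hωt).symm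
    rw [e, ← ENNReal.ofReal_div_of_pos hω, ← ENNReal.ofReal_natCast,
      ← ENNReal.ofReal_mul (Nat.cast_nonneg _)]
    congr 1
    simp only [Polynomial.eval_mul, Polynomial.eval_C, Polynomial.eval_pow, Polynomial.eval_X]
    rw [← mul_assoc, ← hq, mul_pow, mul_comm]
    have e2 : q ^ (n + 1) * R ^ (n + 1) / ω = q ^ (n + 1) / ω * R ^ (n + 1) := by ring
    rw [e2]
    rfl

end
end
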